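/- Let T be a d-angulation of a convex n-gon and let e = (i,i+1), f = (j,j+1) be distinct boundary edges. Then d(e,f) = m_{i,j} m_{i+1,j+1} − m_{i,j+1} m_{i+1,j} equals 1 if and only if there is a sequence e = z_0, z_1, …, z_s = f, with z_1,…,z_{s−1} diagonals of T, such that for every k: z_k and z_{k+1} lie on a common d-gon p_k of T, the d-gons p_0,…,p_{s−1} are pairwise distinct, and z_k shares an endpoint with z_{k+1}. -/

import Mathlib

noncomputable section

/-- The `k`-th vertex of a regular `n`-gon inscribed in the unit circle. -/
def vtx (n : ℕ) (k : ZMod n) : ℝ × ℝ :=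
  (Real.cos (2 * Real.pi * k.val / n), Real.sin (2 * Real.pi * k.val / n))

/-- The convex hull spanned by a set `c` of vertices of the `n`-gon. -/
def cellHull (n : ℕ) (c : Finset (ZMod n)) : Set (ℝ × ℝ) :=
  convexHull ℝ (vtx n '' (c : Set (ZMod n)))

/-- `T` is a `d`-angulation of the convex `n`-gon: a dissection of the polygon by
pairwise non-crossing diagonals into `d`-gon cells.  Each cell is recorded by its
vertex set; the cells cover the polygon and have pairwise disjoint interiors. -/
def IsDAngulation (n d : ℕ) (T : Finset (Finset (ZMod n))) : Prop :=
  (∀ c ∈ T, c.card = d) ∧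
  (⋃ c ∈ T, cellHull n c) = convexHull ℝ (Set.range (vtx n)) ∧
  ∀ c ∈ T, ∀ c' ∈ T, c ≠ c' →
    interior (cellHull n c) ∩ interior (cellHull n c') = ∅

/-- The number of vertices strictly between `i` and `j`, going counterclockwise. -/
def pathLen (n : ℕ) (i j : ZMod n) : ℕ := (j - i - 1).val

/-- A (counterclockwise) `d`-path from `i` to `j` in the `d`-angulation `T`:
a sequence `p_{i+1}, …, p_{j-1}` of cells of `T`, indexed by the vertices
encountered going counterclockwise from `i` to `j`, such that the cell at
position `k` is incident to the vertex `i+1+k`, and each cell of `T` occurs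
at most `d - 2` times in the sequence. -/
def IsDPath (n d : ℕ) (T : Finset (Finset (ZMod n))) (i j : ZMod n)
    (q : Fin (pathLen n i j) → {c // c ∈ T}) : Prop :=
  (∀ k, (i + 1 + ((k : ℕ) : ZMod n)) ∈ (q k : Finset (ZMod n))) ∧
  ∀ c ∈ T, (Finset.univ.filter (fun k => (q k : Finset (ZMod n)) = c)).card ≤ d - 2

/-- The number `m_{i,j}` of counterclockwise `d`-paths from `i` to `j`. -/
def dPathCount (n d : ℕ) (T : Finset (Finset (ZMod n))) (i j : ZMod n) : ℕ :=
  Nat.card {q : Fin (pathLen n i j) → {c // c ∈ T} // IsDPath n d T i j q}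

/-- `v` lies on the closed counterclockwise arc from `a` to `b`. -/
def InArc (n : ℕ) (a b v : ZMod n) : Prop := (v - a).val ≤ (b - a).val

/-- `a` and `b` are endpoints of a side of the cell `c`: a pair of distinct vertices
of `c` such that one of the two arcs between `a` and `b` contains no further
vertex of `c`. -/
def IsCellEdge (n : ℕ) (c : Finset (ZMod n)) (a b : ZMod n) : Prop :=
  a ∈ c ∧ b ∈ c ∧ a ≠ b ∧
  ((∀ v ∈ c, InArc n a b v → v = a ∨ v = b) ∨
   (∀ v ∈ c, InArc n b a v → v = a ∨ v = b))

/-- The unordered pair `z` is a side of the cell `c`. -/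
def SideOf (n : ℕ) (c : Finset (ZMod n)) (z : Sym2 (ZMod n)) : Prop :=
  ∃ a b, z = s(a, b) ∧ IsCellEdge n c a b

/-- `z` is a boundary edge of the `n`-gon (joining consecutive vertices). -/
def IsBoundaryEdge (n : ℕ) (z : Sym2 (ZMod n)) : Prop := ∃ a, z = s(a, a + 1)

/-- `z` is a diagonal used in the `d`-angulation `T`: a side of some cell that is
not a boundary edge of the polygon. -/
def IsDiagonal (n : ℕ) (T : Finset (Finset (ZMod n))) (z : Sym2 (ZMod n)) : Prop :=
  (∃ c ∈ T, SideOf n c z) ∧ ¬ IsBoundaryEdge n z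

open Finset Classical in
/-- The number of ways to assign to every element of `S` a member of `T` containing it,
using each member of `T` at most `D` times. -/
def assignCount {V : Type*} [Fintype V] (D : ℕ) (T : Finset (Finset V)) (S : Finset V) : ℕ :=
  #{q : V → Finset V | (∀ v ∈ S, q v ∈ T ∧ v ∈ q v) ∧ (∀ v ∉ S, q v = ∅) ∧
    ∀ c ∈ T, #{v ∈ S | q v = c} ≤ D}

theorem assignCount_eq_natCard {V : Type*} [Fintype V] [inst : DecidableEq V] (D : ℕ)
    (T : Finset (Finset V)) (S : Finset V) :
    assignCount D T S = Nat.card {q : V → Finset V // (∀ v ∈ S, q v ∈ T ∧ v ∈ q v) ∧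
      (∀ v ∉ S, q v = ∅) ∧ ∀ c ∈ T, (S.filter (q · = c)).card ≤ D} := by
  obtain rfl : inst = fun a b => Classical.propDecidable (a = b) := Subsingleton.elim _ _
  refine (Nat.subtype_card _ fun q => ?_).symm
  simp only [Finset.mem_filter, Finset.mem_univ, true_and]

section Assignments

open Finset Classical

variable {V : Type*} [Fintype V] {D : ℕ} {T T₁ T₂ : Finset (Finset V)} {S S₁ S₂ : Finset V}

theorem assignCount_empty (D : ℕ) (T : Finset (Finset V)) : assignCount D T ∅ = 1 := by
  rw [assignCount, card_eq_one]
  refine ⟨fun _ => ∅, ?_⟩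
  ext q
  simp [funext_iff]

theorem assignCount_singleton {c : Finset V} (hS : S ⊆ c) (hD : #S ≤ D) :
    assignCount D {c} S = 1 := by
  rw [assignCount, card_eq_one]
  refine ⟨fun v => if v ∈ S then c else ∅, ?_⟩
  ext q
  simp only [mem_filter, mem_univ, true_and, mem_singleton, funext_iff]
  constructor
  · rintro ⟨h1, h2, -⟩ v
    split_ifs with hv
    · exact (h1 v hv).1
    · exact h2 v hv
  · intro h
    refine ⟨fun v hv => ?_, fun v hv => ?_, fun c' _ => (card_filter_le _ _).trans hD⟩
    · rw [h v, if_pos hv]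
      exact ⟨rfl, hS hv⟩
    · rw [h v, if_neg hv]

theorem exists_mem_of_assignCount_ne_zero (h : assignCount D T S ≠ 0) {v : V} (hv : v ∈ S) :
    ∃ c ∈ T, v ∈ c := by
  obtain ⟨q, hq⟩ := card_ne_zero.mp h
  simp only [mem_filter, mem_univ, true_and] at hq
  exact ⟨q v, hq.1 v hv⟩

theorem card_le_of_assignCount_ne_zero (h : assignCount D T S ≠ 0) : #S ≤ D * #T := by
  obtain ⟨q, hq⟩ := card_ne_zero.mp h
  simp only [mem_filter, mem_univ, true_and] at hq
  exact card_le_mul_card_image_of_maps_to (f := q) (fun v hv => (hq.1 v hv).1) D hq.2.2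

/-- Splitting the available sets into two classes gives a convolution over subsets. -/
theorem assignCount_union (hT : Disjoint T₁ T₂) (S : Finset V) :
    assignCount D (T₁ ∪ T₂) S =
      ∑ S₁ ∈ S.powerset, assignCount D T₁ S₁ * assignCount D T₂ (S \ S₁) := by
  rw [assignCount, card_eq_sum_card_fiberwise (t := S.powerset)
    (f := fun q => {v ∈ S | q v ∈ T₁}) (fun q _ => mem_powerset.2 (filter_subset _ _))]
  refine sum_congr rfl fun S₁ hS₁ => ?_
  rw [mem_powerset] at hS₁
  rw [assignCount, assignCount, ← card_product]
  refine card_nbij' (fun q => (fun v => if v ∈ S₁ then q v else ∅,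
    fun v => if v ∈ S₁ then ∅ else q v))
    (fun r v => if v ∈ S₁ then r.1 v else r.2 v) ?_ ?_ ?_ ?_
  · intro q hq
    simp only [coe_filter, mem_filter, mem_univ, true_and, Set.mem_ofPred_eq] at hq
    obtain ⟨⟨h1, h2, h3⟩, h4⟩ := hq
    have h5 : ∀ v ∈ S, (q v ∈ T₁ ↔ v ∈ S₁) := fun v hv => by rw [← h4]; simp [hv]
    simp only [coe_product, Set.mem_prod, coe_filter, mem_univ, true_and, Set.mem_ofPred_eq]
    refine ⟨⟨fun v hv => ?_, fun v hv => by simp [hv], fun c hc => ?_⟩,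
      fun v hv => ?_, fun v hv => ?_, fun c hc => ?_⟩
    · simpa [hv] using ⟨(h5 v (hS₁ hv)).2 hv, (h1 v (hS₁ hv)).2⟩
    · refine le_trans (card_le_card ?_) (h3 c (mem_union_left _ hc))
      intro v hv
      simp only [mem_filter] at hv ⊢
      exact ⟨hS₁ hv.1, by simpa [hv.1] using hv.2⟩
    · rw [mem_sdiff] at hv
      have h6 : q v ∉ T₁ := fun h => hv.2 ((h5 v hv.1).1 h)
      have h7 := h1 v hv.1
      rw [mem_union] at h7
      simpa [hv.2] using ⟨h7.1.resolve_left h6, h7.2⟩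
    · by_cases h : v ∈ S₁
      · simp [h]
      · simp only [mem_sdiff, h, not_false_eq_true, and_true] at hv
        simp [h, h2 v hv]
    · refine le_trans (card_le_card ?_) (h3 c (mem_union_right _ hc))
      intro v hv
      simp only [mem_filter, mem_sdiff] at hv ⊢
      exact ⟨hv.1.1, by simpa [hv.1.2] using hv.2⟩
  · rintro ⟨r, t⟩ h
    simp only [coe_product, Set.mem_prod, coe_filter, mem_univ, true_and, Set.mem_ofPred_eq] at h
    obtain ⟨⟨a1, a2, a3⟩, b1, b2, b3⟩ := h
    have b1' : ∀ v ∈ S, v ∉ S₁ → t v ∈ T₂ ∧ v ∈ t v := fun v hv hv' =>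
      b1 v (mem_sdiff.2 ⟨hv, hv'⟩)
    simp only [coe_filter, mem_filter, mem_univ, true_and, Set.mem_ofPred_eq]
    refine ⟨⟨fun v hv => ?_, fun v hv => ?_, fun c hc => ?_⟩, ?_⟩
    · by_cases h : v ∈ S₁
      · simpa [h] using ⟨Or.inl (a1 v h).1, (a1 v h).2⟩
      · simpa [h] using ⟨Or.inr (b1' v hv h).1, (b1' v hv h).2⟩
    · have h : v ∉ S₁ := fun h => hv (hS₁ h)
      simp [h, b2 v (by simp [hv])]
    · rcases mem_union.1 hc with hc | hc
      · refine le_trans (card_le_card ?_) (a3 c hc)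
        intro v hv
        simp only [mem_filter] at hv ⊢
        by_cases h : v ∈ S₁
        · simpa [h] using hv.2
        · have h8 := (b1' v hv.1 h).1
          simp only [h, if_false] at hv
          exact absurd (hv.2 ▸ h8) (disjoint_left.1 hT hc)
      · refine le_trans (card_le_card ?_) (b3 c hc)
        intro v hv
        simp only [mem_filter, mem_sdiff] at hv ⊢
        by_cases h : v ∈ S₁
        · have h8 := (a1 v h).1
          simp only [h, if_true] at hv
          exact absurd hc (disjoint_left.1 hT (hv.2 ▸ h8))
        · simpa [h, hv.1] using hv.2
    · ext v
      simp only [mem_filter]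
      by_cases h : v ∈ S₁
      · simp [h, hS₁ h, (a1 v h).1]
      · simp only [h, if_false, iff_false, not_and]
        intro hv
        exact disjoint_right.1 hT (b1' v hv h).1
  · intro q _
    funext v
    by_cases h : v ∈ S₁ <;> simp [h]
  · rintro ⟨r, t⟩ h
    simp only [coe_product, Set.mem_prod, coe_filter, mem_univ, true_and, Set.mem_ofPred_eq] at h
    obtain ⟨⟨a1, a2, a3⟩, b1, b2, b3⟩ := h
    ext v : 2
    · by_cases h : v ∈ S₁ <;> simp [h, a2 v]
    · by_cases h : v ∈ S₁ <;> simp [h, b2 v]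

/-- If `T₂` misses `S₁` and `T₁` misses `S₂`, the assignments decouple. -/
theorem assignCount_union_of_separated (hT : Disjoint T₁ T₂) (hS : Disjoint S₁ S₂)
    (h₁ : ∀ c ∈ T₂, Disjoint c S₁) (h₂ : ∀ c ∈ T₁, Disjoint c S₂) :
    assignCount D (T₁ ∪ T₂) (S₁ ∪ S₂) = assignCount D T₁ S₁ * assignCount D T₂ S₂ := by
  rw [assignCount_union hT, sum_eq_single S₁]
  · rw [union_sdiff_cancel_left hS]
  · intro R hR hne
    rw [mem_powerset] at hR
    by_contra h
    obtain ⟨h3, h4⟩ := mul_ne_zero_iff.1 h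
    refine hne (Subset.antisymm (fun v hv => ?_) (fun v hv => ?_))
    · obtain ⟨c, hc, hvc⟩ := exists_mem_of_assignCount_ne_zero h3 hv
      exact (mem_union.1 (hR hv)).resolve_right (disjoint_left.1 (h₂ c hc) hvc)
    · by_contra hvR
      obtain ⟨c, hc, hvc⟩ := exists_mem_of_assignCount_ne_zero h4
        (mem_sdiff.2 ⟨mem_union_left _ hv, hvR⟩)
      exact disjoint_left.1 (h₁ c hc) hvc hv
  · exact fun h => absurd (mem_powerset.2 subset_union_left) h

/-- Members of the family missing `S` are irrelevant. -/
theorem assignCount_eq_of_subset (hT : T₁ ⊆ T) (h : ∀ c ∈ T, c ∉ T₁ → Disjoint c S) :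
    assignCount D T S = assignCount D T₁ S := by
  have h1 := assignCount_union_of_separated (D := D) (T₁ := T₁) (T₂ := T \ T₁) (S₁ := S)
    (S₂ := ∅) disjoint_sdiff (disjoint_empty_right _)
    (fun c hc => h c (mem_sdiff.1 hc).1 (mem_sdiff.1 hc).2) (fun c _ => disjoint_empty_right _)
  rwa [union_sdiff_of_subset hT, union_empty, assignCount_empty, mul_one] at h1

/-- The family `T` can be used on `S` in exactly one way, and is then used up. -/
def IsTight (D : ℕ) (T : Finset (Finset V)) (S : Finset V) : Prop :=
  #S = D * #T ∧ assignCount D T S = 1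

theorem isTight_empty : IsTight D (∅ : Finset (Finset V)) ∅ :=
  ⟨by simp, assignCount_empty D ∅⟩

theorem IsTight.assignCount_union (h : IsTight D T₁ S₁) (hT : Disjoint T₁ T₂)
    (hS : Disjoint S₁ S₂) (h₁ : ∀ c ∈ T₂, Disjoint c S₁) :
    assignCount D (T₁ ∪ T₂) (S₁ ∪ S₂) = assignCount D T₂ S₂ := by
  rw [_root_.assignCount_union hT, sum_eq_single S₁]
  · rw [union_sdiff_cancel_left hS, h.2, one_mul]
  · intro R hR hne
    rw [mem_powerset] at hR
    by_contra h0
    obtain ⟨h3, h4⟩ := mul_ne_zero_iff.1 h0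
    refine hne (eq_of_subset_of_card_le (fun v hv => ?_) ?_).symm
    · by_contra hvR
      obtain ⟨c, hc, hvc⟩ := exists_mem_of_assignCount_ne_zero h4
        (mem_sdiff.2 ⟨mem_union_left _ hv, hvR⟩)
      exact disjoint_left.1 (h₁ c hc) hvc hv
    · exact h.1 ▸ card_le_of_assignCount_ne_zero h3
  · exact fun h => absurd (mem_powerset.2 subset_union_left) h

theorem IsTight.union (h : IsTight D T₁ S₁) (h' : IsTight D T₂ S₂) (hT : Disjoint T₁ T₂)
    (hS : Disjoint S₁ S₂) (h₁ : ∀ c ∈ T₂, Disjoint c S₁) :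
    IsTight D (T₁ ∪ T₂) (S₁ ∪ S₂) := by
  refine ⟨?_, by rw [h.assignCount_union hT hS h₁, h'.2]⟩
  rw [card_union_of_disjoint hT, card_union_of_disjoint hS, h.1, h'.1, mul_add]

/-- When `T₁` and `T₂` meet only in `a`, as far as `A ∪ B ∪ {a}` is concerned, an assignment
on this set treats `a` either by `T₁` or by `T₂`. -/
theorem assignCount_insert_union {A B : Finset V} {a : V} (hT : Disjoint T₁ T₂)
    (hAB : Disjoint A B) (haA : a ∉ A) (haB : a ∉ B)
    (h₁ : ∀ c ∈ T₂, Disjoint c B) (h₂ : ∀ c ∈ T₁, Disjoint c A) :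
    assignCount D (T₁ ∪ T₂) (insert a (A ∪ B)) =
      assignCount D T₁ B * assignCount D T₂ (insert a A) +
        assignCount D T₁ (insert a B) * assignCount D T₂ A := by
  have hne : B ≠ insert a B := fun h => haB (h ▸ mem_insert_self a B)
  have hd := disjoint_left.1 hAB
  rw [assignCount_union hT, ← sum_subset (s₁ := {B, insert a B})]
  · rw [sum_pair hne]
    congr 3 <;> ext v <;> grind
  · intro R hR
    simp only [mem_insert, mem_singleton] at hR
    rw [mem_powerset]
    intro v hv
    grind
  · intro R hR hne
    rw [mem_powerset] at hR
    by_contra h0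
    obtain ⟨h3, h4⟩ := mul_ne_zero_iff.1 h0
    have hBR : ∀ v ∈ B, v ∈ R := by
      intro v hv
      by_contra hvR
      obtain ⟨c, hc, hvc⟩ := exists_mem_of_assignCount_ne_zero h4
        (mem_sdiff.2 ⟨mem_insert_of_mem (mem_union_right _ hv), hvR⟩)
      exact disjoint_left.1 (h₁ c hc) hvc hv
    have hRA : ∀ v ∈ R, v ∉ A := by
      intro v hv
      obtain ⟨c, hc, hvc⟩ := exists_mem_of_assignCount_ne_zero h3 hv
      exact disjoint_left.1 (h₂ c hc) hvc
    have hRB : ∀ v ∈ R, v = a ∨ v ∈ B := fun v hv => by grind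
    apply hne
    rw [mem_insert, mem_singleton]
    by_cases ha : a ∈ R
    · right; ext v; grind
    · left; ext v; grind

/-- The Ptolemy relation for counts in a family glued from two tight families. -/
theorem assignCount_ptolemy {A B I₁ I₂ X Y Z : Finset V} {a : V}
    (t₁ : IsTight D T₁ I₁) (t₂ : IsTight D T₂ I₂) (hT : Disjoint T₁ T₂)
    (hTc : ∀ c, c ∈ T ↔ c ∈ T₁ ∨ c ∈ T₂)
    (hI : Disjoint I₁ I₂) (h₁ : ∀ c ∈ T₂, Disjoint c I₁) (h₂ : ∀ c ∈ T₁, Disjoint c I₂)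
    (ha₁ : a ∉ I₁) (ha₂ : a ∉ I₂) (hA : A ⊆ I₂) (hB : B ⊆ I₁)
    (hX : ∀ v, v ∈ X ↔ v = a ∨ v ∈ A ∨ v ∈ B) (hY : ∀ v, v ∈ Y ↔ v = a ∨ v ∈ I₂ ∨ v ∈ B)
    (hZ : ∀ v, v ∈ Z ↔ v = a ∨ v ∈ A ∨ v ∈ I₁) :
    assignCount D T X =
      assignCount D T A * assignCount D T Y + assignCount D T Z * assignCount D T B := by
  obtain rfl : T = T₁ ∪ T₂ := by ext c; rw [hTc, mem_union]
  obtain rfl : X = insert a (A ∪ B) := by ext v; rw [hX, mem_insert, mem_union]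
  obtain rfl : Y = I₂ ∪ insert a B := by ext v; rw [hY, mem_union, mem_insert, or_left_comm]
  obtain rfl : Z = I₁ ∪ insert a A := by ext v; rw [hZ, mem_union, mem_insert]; tauto
  have hB₂ : ∀ c ∈ T₂, Disjoint c B := fun c hc => (h₁ c hc).mono_right hB
  have hA₁ : ∀ c ∈ T₁, Disjoint c A := fun c hc => (h₂ c hc).mono_right hA
  rw [assignCount_eq_of_subset (S := A) subset_union_right
      (fun c hc hc' => hA₁ c ((mem_union.1 hc).resolve_right hc')),
    assignCount_eq_of_subset (S := B) subset_union_left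
      (fun c hc hc' => hB₂ c ((mem_union.1 hc).resolve_left hc')),
    t₁.assignCount_union hT (disjoint_insert_right.2 ⟨ha₁, hI.mono_right hA⟩) h₁,
    assignCount_insert_union hT (hI.symm.mono hA hB) (fun h => ha₂ (hA h))
      (fun h => ha₁ (hB h)) hB₂ hA₁, union_comm T₁,
    t₂.assignCount_union hT.symm (disjoint_insert_right.2 ⟨ha₂, hI.symm.mono_right hB⟩) h₂]
  ring

end Assignments

section Linear

open Finset Classical

variable {V : Type*} [Fintype V]

/-- The members of `T` lying between `u` and `w`, where `pos` gives the position of a vertex. -/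
def within (pos : V → ℕ) (T : Finset (Finset V)) (u w : V) : Finset (Finset V) :=
  {c ∈ T | ∀ v ∈ c, pos u ≤ pos v ∧ pos v ≤ pos w}

/-- The vertices strictly between `u` and `w`. -/
def openInterval (pos : V → ℕ) (u w : V) : Finset V :=
  {v | pos u < pos v ∧ pos v < pos w}

theorem mem_within_iff {pos : V → ℕ} {T : Finset (Finset V)} {u w : V} {c : Finset V} :
    c ∈ within pos T u w ↔ c ∈ T ∧ ∀ v ∈ c, pos u ≤ pos v ∧ pos v ≤ pos w :=
  mem_filter

theorem mem_openInterval {pos : V → ℕ} {u v w : V} :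
    v ∈ openInterval pos u w ↔ pos u < pos v ∧ pos v < pos w := by
  simp [openInterval]

/-- No member of `T` has vertices strictly on both sides of the chord `u w`. -/
def Uncrossed (pos : V → ℕ) (T : Finset (Finset V)) (u w : V) : Prop :=
  ∀ c ∈ T, (∀ v ∈ c, pos u ≤ pos v ∧ pos v ≤ pos w) ∨ ∀ v ∈ c, pos v ≤ pos u ∨ pos w ≤ pos v

/-- The combinatorial content of a `(D + 2)`-angulation of a polygon whose vertices are numbered
by `pos`: the cells do not cross, and every uncrossed chord that cuts off further vertices
supports a cell on that side. -/
structure IsAngulated (pos : V → ℕ) (D : ℕ) (T : Finset (Finset V)) : Prop where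
  injective : Function.Injective pos
  pos_size : 1 ≤ D
  card_eq : ∀ c ∈ T, #c = D + 2
  noncrossing : ∀ c ∈ T, ∀ c' ∈ T, c ≠ c' → ∀ a ∈ c, ∀ b ∈ c, ∀ x ∈ c', ∀ y ∈ c',
    pos a < pos x → pos x < pos b → pos b < pos y → False
  exists_cell : ∀ u w, pos u < pos w → Uncrossed pos T u w → (openInterval pos u w).Nonempty →
    ∃ c ∈ within pos T u w, u ∈ c ∧ w ∈ c

namespace IsAngulated

variable {pos : V → ℕ} {D : ℕ} {T : Finset (Finset V)} (h : IsAngulated pos D T)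
  {c c' : Finset V} {u v w : V}

include h

theorem not_subset_pair (hc : c ∈ T) (u w : V) : ∃ v ∈ c, v ≠ u ∧ v ≠ w := by
  by_contra! h0
  have h1 : c ⊆ {u, w} := fun v hv => by
    by_cases hvu : v = u
    · simp [hvu]
    · simp [h0 v hv hvu]
  have h2 := (card_le_card h1).trans card_le_two
  have := h.card_eq c hc
  have := h.pos_size
  omega

theorem exists_mem_sdiff (hc : c ∈ T) (hc' : c' ∈ T) (hne : c ≠ c') : ∃ v ∈ c', v ∉ c := by
  by_contra! h0
  exact hne (eq_of_subset_of_card_le h0 (by rw [h.card_eq c hc, h.card_eq c' hc'])).symm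

/-- A cell having a vertex strictly between two vertices of another cell lies between them. -/
theorem mem_within (hc : c ∈ T) (hc' : c' ∈ T) (hne : c ≠ c') (hu : u ∈ c) (hw : w ∈ c)
    (hv : v ∈ c') (huv : pos u < pos v) (hvw : pos v < pos w) : c' ∈ within pos T u w := by
  refine mem_filter.2 ⟨hc', fun y hy => ⟨?_, ?_⟩⟩
  · by_contra! hlt
    exact h.noncrossing c' hc' c hc hne.symm y hy v hv u hu w hw hlt huv hvw
  · by_contra! hlt
    exact h.noncrossing c hc c' hc' hne u hu w hw v hv y hy huv hvw hlt

theorem uncrossed_of_side (hc : c ∈ T) (hu : u ∈ c) (hw : w ∈ c)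
    (hcon : ∀ v ∈ c, pos v ≤ pos u ∨ pos w ≤ pos v) : Uncrossed pos T u w := by
  intro c' hc'
  by_cases hne : c = c'
  · exact Or.inr (hne ▸ hcon)
  by_contra! h0
  obtain ⟨⟨y, hy, hyb⟩, v, hv, huv, hvw⟩ := h0
  have h1 := (mem_filter.1 (h.mem_within hc hc' hne hu hw hv huv hvw)).2 y hy
  have := hyb h1.1
  omega

/-- There is at most one cell on each side of a chord. -/
theorem eq_of_mem_within (hc : c ∈ within pos T u w) (hc' : c' ∈ within pos T u w)
    (hu : u ∈ c) (hw : w ∈ c) (hu' : u ∈ c') (hw' : w ∈ c') : c = c' := by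
  by_contra hne
  obtain ⟨hcT, hcb⟩ := mem_filter.1 hc
  obtain ⟨hcT', hcb'⟩ := mem_filter.1 hc'
  obtain ⟨v, hv, hvc⟩ := h.exists_mem_sdiff hcT hcT' hne
  obtain ⟨x, hx, hxc⟩ := h.exists_mem_sdiff hcT' hcT (Ne.symm hne)
  have key : ∀ y z, y ∈ c → z ∈ c' → y ∉ c' → z ∉ c → pos y ≠ pos z := fun y z h1 _ _ h4 h5 =>
    h4 (h.injective h5 ▸ h1)
  have h1 : ∀ y z : V, y ≠ z → pos y ≠ pos z := fun y z hyz h5 => hyz (h.injective h5)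
  have b1 := hcb x hx
  have b2 := hcb' v hv
  have n1 := h1 x u (by rintro rfl; exact hxc hu')
  have n2 := h1 x w (by rintro rfl; exact hxc hw')
  have n3 := h1 v u (by rintro rfl; exact hvc hu)
  have n4 := h1 v w (by rintro rfl; exact hvc hw)
  rcases lt_trichotomy (pos x) (pos v) with hlt | heq | hlt
  · exact h.noncrossing c' hcT' c hcT (Ne.symm hne) u hu' v hv x hx w hw (by omega) hlt (by omega)
  · exact key x v hx hv hxc hvc heq
  · exact h.noncrossing c hcT c' hcT' hne u hu x hx v hv w hw' (by omega) hlt (by omega)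

theorem within_eq_empty (hI : openInterval pos u w = ∅) : within pos T u w = ∅ := by
  by_contra hne
  obtain ⟨c, hc⟩ := nonempty_iff_ne_empty.2 hne
  obtain ⟨hcT, hcb⟩ := mem_filter.1 hc
  obtain ⟨v, hv, hvu, hvw⟩ := h.not_subset_pair hcT u w
  have h1 := hcb v hv
  have h2 : pos v ≠ pos u := fun e => hvu (h.injective e)
  have h3 : pos v ≠ pos w := fun e => hvw (h.injective e)
  have h4 : v ∈ openInterval pos u w := by
    simp only [openInterval, mem_filter, mem_univ, true_and]; omega
  simp [hI] at h4

/-- If the parts cut off by the sides of `c` between `u` and `w` are tight, then so is their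
union. -/
theorem isTight_erase (hc : c ∈ T) (hu : u ∈ c)
    (H : ∀ a ∈ c, ∀ b ∈ c, pos u ≤ pos a → pos a < pos b → pos b ≤ pos w →
      (∀ v ∈ c, pos v ≤ pos a ∨ pos b ≤ pos v) →
      IsTight D (within pos T a b) (openInterval pos a b))
    (hw : w ∈ c) (huw : pos u < pos w) :
    IsTight D ((within pos T u w).erase c) (openInterval pos u w \ c) := by
  induction hk : pos w using Nat.strong_induction_on generalizing w with
  | _ k ih =>
  subst hk
  by_cases hI : ∃ b ∈ c, pos u < pos b ∧ pos b < pos w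
  · have hne : {b ∈ c | pos u < pos b ∧ pos b < pos w}.Nonempty := by
      obtain ⟨b, hb, hb'⟩ := hI
      exact ⟨b, mem_filter.2 ⟨hb, hb'⟩⟩
    obtain ⟨b, hb, hmax⟩ := exists_max_image _ pos hne
    obtain ⟨hbc, hub, hbw⟩ := mem_filter.1 hb
    have hcon : ∀ v ∈ c, pos v ≤ pos b ∨ pos w ≤ pos v := by
      intro v hv
      by_contra! h0
      have := hmax v (mem_filter.2 ⟨hv, by omega⟩)
      omega
    have t₁ := ih (pos b) hbw (w := b)
      (fun a ha b' hb' h1 h2 h3 h4 => H a ha b' hb' h1 h2 (by omega) h4) hbc hub rfl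
    have t₂ := H b hbc w hw hub.le hbw le_rfl hcon
    have hS : openInterval pos u w \ c = (openInterval pos u b \ c) ∪ openInterval pos b w := by
      ext v
      simp only [openInterval, mem_sdiff, mem_filter, mem_univ, true_and, mem_union]
      constructor
      · rintro ⟨⟨h1, h2⟩, h3⟩
        have : pos v ≠ pos b := fun e => h3 (h.injective e ▸ hbc)
        by_cases h4 : pos v < pos b
        · exact Or.inl ⟨⟨h1, h4⟩, h3⟩
        · exact Or.inr ⟨by omega, h2⟩
      · rintro (⟨⟨h1, h2⟩, h3⟩ | ⟨h1, h2⟩)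
        · exact ⟨⟨h1, by omega⟩, h3⟩
        · refine ⟨⟨by omega, h2⟩, fun h3 => ?_⟩
          have := hcon v h3
          omega
    have hTT : (within pos T u w).erase c = (within pos T u b).erase c ∪ within pos T b w := by
      ext c'
      simp only [within, mem_erase, mem_filter, mem_union]
      constructor
      · rintro ⟨hne, hc', hb'⟩
        obtain ⟨x, hx, hxc⟩ := h.exists_mem_sdiff hc hc' (Ne.symm hne)
        have : pos x ≠ pos b := fun e => hxc (h.injective e ▸ hbc)
        have : pos x ≠ pos u := fun e => hxc (h.injective e ▸ hu)
        have : pos x ≠ pos w := fun e => hxc (h.injective e ▸ hw)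
        have := hb' x hx
        by_cases h4 : pos x < pos b
        · exact Or.inl ⟨hne, mem_filter.1
            (h.mem_within hc hc' (Ne.symm hne) hu hbc hx (by omega) h4)⟩
        · exact Or.inr (mem_filter.1
            (h.mem_within hc hc' (Ne.symm hne) hbc hw hx (by omega) (by omega)))
      · rintro (⟨hne, hc', hb'⟩ | ⟨hc', hb'⟩)
        · exact ⟨hne, hc', fun v hv => by have := hb' v hv; omega⟩
        · refine ⟨?_, hc', fun v hv => by have := hb' v hv; omega⟩
          rintro rfl
          have := hb' u hu
          omega
    rw [hS, hTT]
    refine t₁.union t₂ ?_ ?_ ?_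
    · rw [disjoint_left]
      intro c' h1 h2
      rw [mem_erase] at h1
      obtain ⟨h3, h4⟩ := mem_filter.1 h1.2
      obtain ⟨-, h5⟩ := mem_filter.1 h2
      obtain ⟨v, hv, hvb, -⟩ := h.not_subset_pair h3 b b
      exact hvb (h.injective (le_antisymm (h4 v hv).2 (h5 v hv).1))
    · rw [disjoint_left]
      simp only [openInterval, mem_sdiff, mem_filter, mem_univ, true_and]
      intro v h1 h2
      omega
    · intro c' hc'
      rw [disjoint_left]
      intro v hv h1
      have := (mem_filter.1 hc').2 v hv
      simp only [openInterval, mem_sdiff, mem_filter, mem_univ, true_and] at h1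
      omega
  · push Not at hI
    have h1 : c ∉ within pos T u w := by
      intro h1
      obtain ⟨v, hv, hvu, hvw⟩ := h.not_subset_pair hc u w
      have h2 := (mem_filter.1 h1).2 v hv
      have h3 : pos v ≠ pos u := fun e => hvu (h.injective e)
      have h4 : pos v ≠ pos w := fun e => hvw (h.injective e)
      have := hI v hv
      omega
    have h2 : openInterval pos u w \ c = openInterval pos u w := by
      refine sdiff_eq_self_of_disjoint (disjoint_left.2 fun v hv hvc => ?_)
      simp only [openInterval, mem_filter, mem_univ, true_and] at hv
      have := hI v hvc
      omega
    rw [erase_eq_of_notMem h1, h2]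
    exact H u hu w hw le_rfl huw le_rfl fun v hv => by have := hI v hv; omega

/-- The part of the angulation cut off by an uncrossed chord is tight. -/
theorem isTight_within (huw : pos u < pos w) (hun : Uncrossed pos T u w) :
    IsTight D (within pos T u w) (openInterval pos u w) := by
  induction hk : pos w - pos u using Nat.strong_induction_on generalizing u w with
  | _ k ih =>
  subst hk
  rcases (openInterval pos u w).eq_empty_or_nonempty with hI | hI
  · rw [h.within_eq_empty hI, hI]
    exact isTight_empty
  obtain ⟨c, hcw, hu, hw⟩ := h.exists_cell u w huw hun hI
  obtain ⟨hc, hcb⟩ := mem_filter.1 hcw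
  have t₁ := h.isTight_erase hc hu (w := w) (fun a ha b hb h1 h2 h3 h4 => by
    refine ih _ ?_ h2 (h.uncrossed_of_side hc ha hb h4) rfl
    obtain ⟨v, hv, hvu, hvw⟩ := h.not_subset_pair hc u w
    have h5 : pos v ≠ pos u := fun e => hvu (h.injective e)
    have h6 : pos v ≠ pos w := fun e => hvw (h.injective e)
    have := hcb v hv
    have := h4 v hv
    omega) hw huw
  have hne : u ≠ w := by rintro rfl; omega
  have hS : c ∩ openInterval pos u w = (c.erase u).erase w := by
    ext v
    simp only [openInterval, mem_inter, mem_filter, mem_univ, true_and, mem_erase]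
    constructor
    · rintro ⟨h1, h2, h3⟩
      exact ⟨by rintro rfl; omega, by rintro rfl; omega, h1⟩
    · rintro ⟨h1, h2, h3⟩
      have h5 : pos v ≠ pos u := fun e => h2 (h.injective e)
      have h6 : pos v ≠ pos w := fun e => h1 (h.injective e)
      have := hcb v h3
      exact ⟨h3, by omega, by omega⟩
  have hcard : #(c ∩ openInterval pos u w) = D := by
    rw [hS, card_erase_of_mem (by simp [hw, hne.symm]), card_erase_of_mem hu, h.card_eq c hc]
    omega
  have t₂ : IsTight D {c} (c ∩ openInterval pos u w) :=
    ⟨by simp [hcard], assignCount_singleton inter_subset_left hcard.le⟩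
  have t := t₁.union t₂ (by simp) (by
      rw [disjoint_left]; intro v h1 h2; simp only [mem_sdiff, mem_inter] at h1 h2; tauto) (by
    intro c' hc'
    rw [mem_singleton.1 hc']
    exact disjoint_sdiff)
  rwa [union_comm _ {c}, ← insert_eq, insert_erase hcw, inter_comm c, sdiff_union_inter] at t

/-- The number of assignments between two vertices of a common cell is one. -/
theorem assignCount_openInterval (hc : c ∈ T) (hu : u ∈ c) (hw : w ∈ c) (huw : pos u < pos w) :
    assignCount D T (openInterval pos u w) = 1 := by
  have t := h.isTight_erase hc hu (w := w)
    (fun a ha b hb _ h2 _ h4 => h.isTight_within h2 (h.uncrossed_of_side hc ha hb h4)) hw huw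
  set T₁ := (within pos T u w).erase c with hT₁
  have hsub : T₁ ⊆ T := (erase_subset _ _).trans (filter_subset _ _)
  have hmem : ∀ c' ∈ T, c' ≠ c → ∀ v ∈ c', v ∈ openInterval pos u w → c' ∈ T₁ := by
    intro c' hc' hne v hv hvI
    simp only [openInterval, mem_filter, mem_univ, true_and] at hvI
    exact mem_erase.2 ⟨hne, h.mem_within hc hc' hne.symm hu hw hv hvI.1 hvI.2⟩
  have e := t.assignCount_union (T₂ := T \ T₁) (S₂ := openInterval pos u w ∩ c) disjoint_sdiff
    (disjoint_sdiff_inter _ _) (by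
      intro c' hc'
      rw [mem_sdiff] at hc'
      rw [disjoint_left]
      intro v hv hv'
      rw [mem_sdiff] at hv'
      exact hc'.2 (hmem c' hc'.1 (by rintro rfl; exact hv'.2 hv) v hv hv'.1))
  rw [union_sdiff_of_subset hsub, sdiff_union_inter] at e
  rw [e, assignCount_eq_of_subset (T₁ := {c}), assignCount_singleton inter_subset_right]
  · have hsub' : openInterval pos u w ∩ c ⊆ (c.erase u).erase w := by
      intro v hv
      simp only [openInterval, mem_inter, mem_filter, mem_univ, true_and] at hv
      simp only [mem_erase]
      exact ⟨by rintro rfl; omega, by rintro rfl; omega, hv.2⟩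
    refine (card_le_card hsub').trans ?_
    rw [card_erase_of_mem (mem_erase.2 ⟨by rintro rfl; omega, hw⟩), card_erase_of_mem hu,
      h.card_eq c hc]
    omega
  · simp [hc, hT₁]
  · intro c' hc' hne
    rw [mem_sdiff] at hc'
    rw [mem_singleton] at hne
    rw [disjoint_left]
    intro v hv hv'
    exact hc'.2 (hmem c' hc'.1 hne v hv (mem_inter.1 hv').1)

end IsAngulated

end Linear

section Plane

/-- Twice the signed area of the triangle `P Q R`. -/
def signedArea (P Q R : ℝ × ℝ) : ℝ :=
  (Q.1 - P.1) * (R.2 - P.2) - (Q.2 - P.2) * (R.1 - P.1)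

theorem signedArea_smul_eq (P Q R v : ℝ × ℝ) :
    signedArea P Q R • v = (v.1 * (R.2 - P.2) - v.2 * (R.1 - P.1)) • (Q - P) +
      ((Q.1 - P.1) * v.2 - (Q.2 - P.2) * v.1) • (R - P) := by
  ext <;> simp [signedArea] <;> ring

theorem signedArea_combo (P R p q : ℝ × ℝ) {a b : ℝ} (hab : a + b = 1) :
    signedArea P (a • p + b • q) R = a * signedArea P p R + b * signedArea P q R := by
  obtain rfl : b = 1 - a := by linarith
  simp [signedArea]
  ring

theorem convex_signedArea_nonpos (P R : ℝ × ℝ) : Convex ℝ {p | signedArea P p R ≤ 0} := by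
  intro p hp q hq a b ha hb hab
  simp only [Set.mem_ofPred_eq] at *
  rw [signedArea_combo P R p q hab]
  nlinarith [mul_nonneg ha (neg_nonneg.2 hp), mul_nonneg hb (neg_nonneg.2 hq)]

/-- An open half plane together with a point of its boundary is convex. -/
theorem convex_signedArea_pos_union (P R w : ℝ × ℝ) (hw : signedArea P w R = 0) :
    Convex ℝ {p | 0 < signedArea P p R ∨ p = w} := by
  intro p hp q hq a b ha hb hab
  simp only [Set.mem_ofPred_eq] at *
  rw [signedArea_combo P R p q hab]
  rcases hp with hp | rfl <;> rcases hq with hq | rfl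
  · left
    rcases ha.eq_or_lt with rfl | ha
    · obtain rfl : b = 1 := by linarith
      simpa using hq
    · have := mul_pos ha hp
      have := mul_nonneg hb hq.le
      linarith
  · rcases ha.eq_or_lt with rfl | ha
    · obtain rfl : b = 1 := by linarith
      right; simp
    · left; rw [hw]; simpa using mul_pos ha hp
  · rcases hb.eq_or_lt with rfl | hb
    · obtain rfl : a = 1 := by linarith
      right; simp
    · left; rw [hw]; simpa using mul_pos hb hq
  · right
    rw [← add_smul, hab, one_smul]

theorem interior_convexHull_nonempty {s : Set (ℝ × ℝ)} {P Q R : ℝ × ℝ} (hP : P ∈ s) (hQ : Q ∈ s)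
    (hR : R ∈ s) (h : signedArea P Q R ≠ 0) : (interior (convexHull ℝ s)).Nonempty := by
  rw [interior_convexHull_nonempty_iff_affineSpan_eq_top,
    AffineSubspace.affineSpan_eq_top_iff_vectorSpan_eq_top_of_nonempty ℝ _ _ ⟨P, hP⟩, eq_top_iff]
  intro v _
  have h1 : Q - P ∈ vectorSpan ℝ s := vsub_mem_vectorSpan ℝ hQ hP
  have h2 : R - P ∈ vectorSpan ℝ s := vsub_mem_vectorSpan ℝ hR hP
  have h3 : signedArea P Q R • v ∈ vectorSpan ℝ s := by
    rw [signedArea_smul_eq]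
    exact add_mem (Submodule.smul_mem _ _ h1) (Submodule.smul_mem _ _ h2)
  exact (Submodule.smul_mem_iff _ h).1 h3

/-- Two convex sets spanned by sets containing crossing segments have overlapping interiors. -/
theorem interiors_meet_of_crossing {s t : Set (ℝ × ℝ)} {a b x y : ℝ × ℝ}
    (ha : a ∈ s) (hb : b ∈ s) (hx : x ∈ t) (hy : y ∈ t)
    (h₁ : 0 < signedArea a x b) (h₂ : 0 < signedArea a x y) (h₃ : 0 < signedArea a b y)
    (h₄ : 0 < signedArea x b y) (hs : (interior (convexHull ℝ s)).Nonempty)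
    (ht : (interior (convexHull ℝ t)).Nonempty) :
    interior (convexHull ℝ s) ∩ interior (convexHull ℝ t) ≠ ∅ := by
  intro h0
  obtain ⟨f, r, hfs, hft⟩ := geometric_hahn_banach_open_open
    (convex_convexHull ℝ s).interior isOpen_interior (convex_convexHull ℝ t).interior
    isOpen_interior (Set.disjoint_iff_inter_eq_empty.2 h0)
  have hfs' : ∀ p ∈ convexHull ℝ s, f p ≤ r := by
    intro p hp
    have h1 := ((convex_convexHull ℝ s).closure_interior_eq_closure_of_nonempty_interior hs).ge
      (subset_closure hp)
    exact closure_minimal (fun p hp => (hfs p hp).le)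
      (isClosed_le f.continuous continuous_const) h1
  have hft' : ∀ p ∈ convexHull ℝ t, r ≤ f p := by
    intro p hp
    have h1 := ((convex_convexHull ℝ t).closure_interior_eq_closure_of_nonempty_interior ht).ge
      (subset_closure hp)
    exact closure_minimal (fun p hp => (hft p hp).le)
      (isClosed_le continuous_const f.continuous) h1
  have hrel : signedArea x b y • a + signedArea a x y • b =
      signedArea a b y • x + signedArea a x b • y := by
    ext <;> simp [signedArea] <;> ring
  have hsum : signedArea x b y + signedArea a x y = signedArea a b y + signedArea a x b := by
    simp [signedArea]; ring
  have hfrel := congrArg f hrel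
  simp only [map_add, map_smul, smul_eq_mul] at hfrel
  have fa := hfs' a (subset_convexHull ℝ s ha)
  have fb := hfs' b (subset_convexHull ℝ s hb)
  have fx := hft' x (subset_convexHull ℝ t hx)
  have fy := hft' y (subset_convexHull ℝ t hy)
  have ka := mul_nonneg h₄.le (sub_nonneg.2 fa)
  have kb := mul_nonneg h₂.le (sub_nonneg.2 fb)
  have kx := mul_nonneg h₃.le (sub_nonneg.2 fx)
  have ky := mul_nonneg h₁.le (sub_nonneg.2 fy)
  have htot : signedArea x b y * (r - f a) + signedArea a x y * (r - f b) +
      signedArea a b y * (f x - r) + signedArea a x b * (f y - r) = 0 := by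
    linear_combination r * hsum - hfrel
  have ea : signedArea x b y * (r - f a) = 0 := by linarith
  have eb : signedArea a x y * (r - f b) = 0 := by linarith
  have ex : signedArea a b y * (f x - r) = 0 := by linarith
  have ea' := (mul_eq_zero.1 ea).resolve_left h₄.ne'
  have eb' := (mul_eq_zero.1 eb).resolve_left h₂.ne'
  have ex' := (mul_eq_zero.1 ex).resolve_left h₃.ne'
  have hf0 : ∀ v, f v = 0 := by
    intro v
    have h1 := congrArg f (signedArea_smul_eq a x b v)
    simp only [map_add, map_smul, smul_eq_mul, map_sub] at h1
    rw [show f x - f a = 0 by linarith, show f b - f a = 0 by linarith] at h1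
    simp only [mul_zero, add_zero] at h1
    exact (mul_eq_zero.1 h1).resolve_left h₁.ne'
  obtain ⟨p, hp⟩ := hs
  obtain ⟨q, hq⟩ := ht
  have h5 := hfs p hp
  have h6 := hft q hq
  rw [hf0] at h5 h6
  linarith

end Plane

section Geometry

variable {n : ℕ} [NeZero n]

/-- The position of `v` when counting counterclockwise from `o`. -/
def cyclePos (o v : ZMod n) : ℕ := (v - o).val

theorem cyclePos_lt (o v : ZMod n) : cyclePos o v < n := ZMod.val_lt _

theorem cyclePos_injective (o : ZMod n) : Function.Injective (cyclePos o) := fun v w h => by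
  simpa using ZMod.val_injective n h

theorem vtx_eq (o v : ZMod n) :
    vtx n v = (Real.cos (2 * (Real.pi * o.val / n + Real.pi * cyclePos o v / n)),
      Real.sin (2 * (Real.pi * o.val / n + Real.pi * cyclePos o v / n))) := by
  have hn : (n : ℝ) ≠ 0 := Nat.cast_ne_zero.2 (NeZero.ne n)
  have h1 : v.val = (o.val + cyclePos o v) % n := by
    rw [cyclePos, ← ZMod.val_add, add_sub_cancel]
  have h2 : (v.val : ℝ) + n * ((o.val + cyclePos o v) / n : ℕ) = o.val + cyclePos o v := by
    rw [h1]; exact_mod_cast Nat.mod_add_div _ _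
  have h3 : 2 * (Real.pi * o.val / n + Real.pi * cyclePos o v / n) =
      2 * Real.pi * v.val / n + ((o.val + cyclePos o v) / n : ℕ) * (2 * Real.pi) := by
    field_simp
    linarith
  rw [h3, Real.cos_add_nat_mul_two_pi, Real.sin_add_nat_mul_two_pi, vtx]

theorem signedArea_circle (A B C : ℝ) :
    signedArea (Real.cos (2 * A), Real.sin (2 * A)) (Real.cos (2 * B), Real.sin (2 * B))
      (Real.cos (2 * C), Real.sin (2 * C)) =
      4 * Real.sin (B - A) * Real.sin (C - B) * Real.sin (C - A) := by
  have h1 : signedArea (Real.cos (2 * A), Real.sin (2 * A)) (Real.cos (2 * B), Real.sin (2 * B))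
      (Real.cos (2 * C), Real.sin (2 * C)) = Real.sin (2 * B - 2 * A) + Real.sin (2 * C - 2 * B)
        - Real.sin (2 * C - 2 * A) := by
    simp only [signedArea, Real.sin_sub]; ring
  obtain ⟨x, rfl⟩ : ∃ x, B = A + x := ⟨B - A, by ring⟩
  obtain ⟨y, rfl⟩ : ∃ y, C = A + x + y := ⟨C - (A + x), by ring⟩
  rw [h1, show 2 * (A + x) - 2 * A = 2 * x by ring,
    show 2 * (A + x + y) - 2 * (A + x) = 2 * y by ring,
    show 2 * (A + x + y) - 2 * A = 2 * x + 2 * y by ring, show A + x - A = x by ring,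
    show A + x + y - (A + x) = y by ring, show A + x + y - A = x + y by ring,
    Real.sin_add, Real.sin_add, Real.sin_two_mul, Real.sin_two_mul, Real.cos_two_mul,
    Real.cos_two_mul]
  linear_combination
    (-4 * Real.sin x * Real.cos x) * Real.sin_sq_add_cos_sq y +
    (-4 * Real.sin y * Real.cos y) * Real.sin_sq_add_cos_sq x

theorem signedArea_vtx (o u v w : ZMod n) :
    signedArea (vtx n u) (vtx n v) (vtx n w) =
      4 * Real.sin (Real.pi * ((cyclePos o v : ℝ) - cyclePos o u) / n) *
        Real.sin (Real.pi * ((cyclePos o w : ℝ) - cyclePos o v) / n) *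
        Real.sin (Real.pi * ((cyclePos o w : ℝ) - cyclePos o u) / n) := by
  rw [vtx_eq o u, vtx_eq o v, vtx_eq o w, signedArea_circle]
  congr 3
  · congr 1; ring
  · ring
  · ring

theorem sin_pos_of_cyclePos_lt {o u v : ZMod n} (h : cyclePos o u < cyclePos o v) :
    0 < Real.sin (Real.pi * ((cyclePos o v : ℝ) - cyclePos o u) / n) := by
  have hn : (0 : ℝ) < n := Nat.cast_pos.2 (Nat.pos_of_ne_zero (NeZero.ne n))
  have h1 : (cyclePos o u : ℝ) < cyclePos o v := Nat.cast_lt.2 h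
  have h2 : (cyclePos o v : ℝ) < n := Nat.cast_lt.2 (cyclePos_lt o v)
  have h3 : (0 : ℝ) ≤ cyclePos o u := Nat.cast_nonneg _
  apply Real.sin_pos_of_pos_of_lt_pi
  · have := Real.pi_pos
    have : (0 : ℝ) < (cyclePos o v : ℝ) - cyclePos o u := by linarith
    positivity
  · rw [div_lt_iff₀ hn]
    exact mul_lt_mul_of_pos_left (by linarith) Real.pi_pos

theorem signedArea_vtx_pos {o u v w : ZMod n} (h₁ : cyclePos o u < cyclePos o v)
    (h₂ : cyclePos o v < cyclePos o w) : 0 < signedArea (vtx n u) (vtx n v) (vtx n w) := by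
  rw [signedArea_vtx o]
  have := sin_pos_of_cyclePos_lt h₁
  have := sin_pos_of_cyclePos_lt h₂
  have := sin_pos_of_cyclePos_lt (h₁.trans h₂)
  positivity

theorem signedArea_vtx_nonpos {o u v w : ZMod n} (huw : cyclePos o u < cyclePos o w)
    (h : cyclePos o v ≤ cyclePos o u ∨ cyclePos o w ≤ cyclePos o v) :
    signedArea (vtx n u) (vtx n v) (vtx n w) ≤ 0 := by
  have e₁ : signedArea (vtx n u) (vtx n v) (vtx n w) =
      -signedArea (vtx n v) (vtx n u) (vtx n w) := by simp only [signedArea]; ring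
  have e₂ : signedArea (vtx n u) (vtx n v) (vtx n w) =
      -signedArea (vtx n u) (vtx n w) (vtx n v) := by simp only [signedArea]; ring
  rcases h with h | h
  · rcases h.eq_or_lt with h | h
    · rw [cyclePos_injective o h]; simp [signedArea]
    · rw [e₁]; have := signedArea_vtx_pos h huw; linarith
  · rcases h.eq_or_lt with h | h
    · rw [cyclePos_injective o h]; simp [signedArea]; linarith
    · rw [e₂]; have := signedArea_vtx_pos huw h; linarith

theorem interior_cellHull_nonempty {c : Finset (ZMod n)} (hc : 3 ≤ c.card) :
    (interior (cellHull n c)).Nonempty := by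
  obtain ⟨a, b, e, ha, hb, he, hab, hae, hbe⟩ := Finset.two_lt_card_iff.1 hc
  have hinj := cyclePos_injective (0 : ZMod n)
  refine interior_convexHull_nonempty (P := vtx n a) (Q := vtx n b) (R := vtx n e)
    ⟨a, ha, rfl⟩ ⟨b, hb, rfl⟩ ⟨e, he, rfl⟩ ?_
  have key : ∀ x y : ZMod n, x ≠ y →
      Real.sin (Real.pi * ((cyclePos 0 y : ℝ) - cyclePos 0 x) / n) ≠ 0 := by
    intro x y hxy
    rcases lt_or_gt_of_ne (fun h => hxy (hinj h)) with h | h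
    · exact (sin_pos_of_cyclePos_lt h).ne'
    · have := (sin_pos_of_cyclePos_lt h).ne'
      rwa [← neg_sub, mul_neg, neg_div, Real.sin_neg, neg_ne_zero] at this
  rw [signedArea_vtx 0]
  exact mul_ne_zero (mul_ne_zero (mul_ne_zero four_ne_zero (key a b hab)) (key b e hbe))
    (key a e hae)

omit [NeZero n] in
theorem isClosed_cellHull (c : Finset (ZMod n)) : IsClosed (cellHull n c) :=
  (c.finite_toSet.image _).isClosed_convexHull ℝ

/-- A cell on one side of the chord `u w` whose hull meets the interior of that chord contains
its endpoints. -/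
theorem mem_of_midpoint_mem_cellHull {o u w : ZMod n} {c : Finset (ZMod n)}
    (huw : cyclePos o u < cyclePos o w)
    (hc : ∀ v ∈ c, cyclePos o u ≤ cyclePos o v ∧ cyclePos o v ≤ cyclePos o w)
    (hne : vtx n u ≠ vtx n w)
    (hM : midpoint ℝ (vtx n u) (vtx n w) ∈ cellHull n c) : u ∈ c ∧ w ∈ c := by
  have hinj := cyclePos_injective o
  have hM0 : signedArea (vtx n u) (midpoint ℝ (vtx n u) (vtx n w)) (vtx n w) = 0 := by
    simp [signedArea, midpoint_eq_smul_add]; ring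
  constructor
  · by_contra hu
    have h1 := convexHull_min (t := {p | 0 < signedArea (vtx n u) p (vtx n w) ∨ p = vtx n w})
      (s := vtx n '' (c : Set (ZMod n))) (by
        rintro _ ⟨v, hv, rfl⟩
        have h2 := hc v hv
        by_cases hvw : v = w
        · right; rw [hvw]
        · have h3 : cyclePos o v ≠ cyclePos o w := fun e => hvw (hinj e)
          have h4 : cyclePos o v ≠ cyclePos o u := fun e => hu (hinj e ▸ hv)
          exact Or.inl (signedArea_vtx_pos (o := o) (by omega) (by omega)))
      (convex_signedArea_pos_union _ _ _ (by simp [signedArea]; ring)) hM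
    rcases h1 with h1 | h1
    · exact h1.ne' hM0
    · exact hne (by simpa using h1)
  · by_contra hw
    have h1 := convexHull_min (t := {p | 0 < signedArea (vtx n u) p (vtx n w) ∨ p = vtx n u})
      (s := vtx n '' (c : Set (ZMod n))) (by
        rintro _ ⟨v, hv, rfl⟩
        have h2 := hc v hv
        by_cases hvu : v = u
        · right; rw [hvu]
        · have h3 : cyclePos o v ≠ cyclePos o u := fun e => hvu (hinj e)
          have h4 : cyclePos o v ≠ cyclePos o w := fun e => hw (hinj e ▸ hv)
          exact Or.inl (signedArea_vtx_pos (o := o) (by omega) (by omega)))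
      (convex_signedArea_pos_union _ _ _ (by simp [signedArea])) hM
    rcases h1 with h1 | h1
    · exact h1.ne' hM0
    · exact hne (by simpa using h1)

/-- The cells of a geometric `d`-angulation form a combinatorial one, whichever vertex the
counting starts from. -/
theorem IsDAngulation.isAngulated {d : ℕ} (hd : 3 ≤ d) {T : Finset (Finset (ZMod n))}
    (hT : IsDAngulation n d T) (o : ZMod n) : IsAngulated (cyclePos o) (d - 2) T where
  injective := cyclePos_injective o
  pos_size := by omega
  card_eq c hc := by have := hT.1 c hc; omega
  noncrossing c hc c' hc' hne a ha b hb x hx y hy hax hxb hby :=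
    interiors_meet_of_crossing (s := vtx n '' (c : Set (ZMod n)))
      (t := vtx n '' (c' : Set (ZMod n))) ⟨a, ha, rfl⟩ ⟨b, hb, rfl⟩ ⟨x, hx, rfl⟩ ⟨y, hy, rfl⟩
      (signedArea_vtx_pos hax hxb) (signedArea_vtx_pos hax (hxb.trans hby))
      (signedArea_vtx_pos (hax.trans hxb) hby) (signedArea_vtx_pos hxb hby)
      (interior_cellHull_nonempty (hd.trans (hT.1 c hc).ge))
      (interior_cellHull_nonempty (hd.trans (hT.1 c' hc').ge))
      (hT.2.2 c hc c' hc' hne)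
  exists_cell u w huw hun := by
    classical
    rintro ⟨y, hy⟩
    rw [mem_openInterval] at hy
    have hypos := signedArea_vtx_pos hy.1 hy.2
    set M := midpoint ℝ (vtx n u) (vtx n w) with hM
    have hM0 : signedArea (vtx n u) M (vtx n w) = 0 := by
      simp [signedArea, hM, midpoint_eq_smul_add]; ring
    set B := ⋃ c ∈ T.filter (fun c => M ∉ cellHull n c), cellHull n c with hB
    have hBc : IsClosed B := isClosed_biUnion_finset fun c _ => isClosed_cellHull c
    have hMB : M ∈ Bᶜ := by simp [hB]
    have hcont : Filter.Tendsto (fun t : ℝ => (1 - t) • M + t • vtx n y) (nhdsWithin 0 (Set.Ioi 0))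
        (nhds M) := by
      have : Continuous (fun t : ℝ => (1 - t) • M + t • vtx n y) := by fun_prop
      have h := this.tendsto 0
      simp only [sub_zero, one_smul, zero_smul, add_zero] at h
      exact h.mono_left nhdsWithin_le_nhds
    have hev := (hcont.eventually (hBc.isOpen_compl.mem_nhds hMB)).and
      (Ioo_mem_nhdsGT (zero_lt_one' ℝ))
    obtain ⟨t, htB, ht0, ht1⟩ := hev.exists
    have hmemP : ∀ v : ZMod n, vtx n v ∈ convexHull ℝ (Set.range (vtx n)) := fun v =>
      subset_convexHull ℝ _ ⟨v, rfl⟩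
    have hconv := convex_convexHull ℝ (Set.range (vtx n))
    have hMP : M ∈ convexHull ℝ (Set.range (vtx n)) :=
      hconv.segment_subset (hmemP u) (hmemP w) (midpoint_mem_segment _ _)
    have hQ : (1 - t) • M + t • vtx n y ∈ convexHull ℝ (Set.range (vtx n)) :=
      hconv hMP (hmemP y) (by linarith) ht0.le (by ring)
    rw [← hT.2.1] at hQ
    simp only [Set.mem_iUnion] at hQ
    obtain ⟨c, hc, hQc⟩ := hQ
    have hMc : M ∈ cellHull n c := by
      by_contra hMc
      exact htB (Set.mem_biUnion (Finset.mem_coe.2 (Finset.mem_filter.2 ⟨hc, hMc⟩)) hQc)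
    have hin : ∀ v ∈ c, cyclePos o u ≤ cyclePos o v ∧ cyclePos o v ≤ cyclePos o w := by
      refine (hun c hc).resolve_right fun hout => ?_
      have h1 := convexHull_min (s := vtx n '' (c : Set (ZMod n)))
        (t := {p | signedArea (vtx n u) p (vtx n w) ≤ 0}) (by
          rintro _ ⟨v, hv, rfl⟩
          exact signedArea_vtx_nonpos huw (hout v hv)) (convex_signedArea_nonpos _ _) hQc
      simp only [Set.mem_ofPred_eq] at h1
      rw [signedArea_combo _ _ _ _ (by ring), hM0] at h1
      have := mul_pos ht0 hypos
      linarith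
    refine ⟨c, mem_within_iff.2 ⟨hc, hin⟩, mem_of_midpoint_mem_cellHull huw hin ?_ hMc⟩
    intro h
    rw [h] at hypos
    simp [signedArea] at hypos

end Geometry

section Paths

open Finset

variable {n : ℕ} [NeZero n]

theorem cyclePos_change (o x v : ZMod n) :
    (cyclePos o x ≤ cyclePos o v ∧ cyclePos x v + cyclePos o x = cyclePos o v) ∨
      (cyclePos o v < cyclePos o x ∧ cyclePos x v + cyclePos o x = cyclePos o v + n) := by
  have h : cyclePos o v = (cyclePos x v + cyclePos o x) % n := by
    rw [cyclePos, cyclePos, cyclePos, ← ZMod.val_add, sub_add_sub_cancel]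
  have h1 := cyclePos_lt x v
  have h2 := cyclePos_lt o x
  rcases lt_or_ge (cyclePos x v + cyclePos o x) n with h3 | h3
  · rw [Nat.mod_eq_of_lt h3] at h
    omega
  · rw [Nat.mod_eq_sub_mod h3, Nat.mod_eq_of_lt (by omega)] at h
    omega

omit [NeZero n] in
theorem cyclePos_self (o : ZMod n) : cyclePos o o = 0 := by simp [cyclePos]

theorem cyclePos_ne {o v w : ZMod n} (h : v ≠ w) : cyclePos o v ≠ cyclePos o w :=
  fun e => h (cyclePos_injective o e)

theorem cyclePos_add_one_self (x : ZMod n) : cyclePos (x + 1) x + 1 = n := by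
  have h1 := cyclePos_lt (x + 1) x
  have h : (cyclePos (x + 1) x + 1) % n = 0 := by
    rw [cyclePos, Nat.add_mod, ← ZMod.val_one_eq_one_mod, Nat.mod_eq_of_lt (ZMod.val_lt _),
      ← ZMod.val_add]
    simp
  have := Nat.le_of_dvd (by omega) (Nat.dvd_of_mod_eq_zero h)
  omega

theorem cyclePos_add_one_left {x v : ZMod n} (hv : v ≠ x) :
    cyclePos (x + 1) v + 1 = cyclePos x v := by
  have h1 := cyclePos_change x (x + 1) v
  have h2 := cyclePos_change x (x + 1) x
  have h3 := cyclePos_add_one_self x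
  have h4 := cyclePos_self x
  have h5 := cyclePos_ne (o := x) hv
  have h6 := cyclePos_lt x v
  omega

theorem cyclePos_add_one_right {o v : ZMod n} (h : cyclePos o v + 1 < n) :
    cyclePos o (v + 1) = cyclePos o v + 1 := by
  have : v + 1 - o = v - o + 1 := by ring
  rw [cyclePos, this, ZMod.val_add, ZMod.val_one_eq_one_mod, Nat.add_mod_mod]
  exact Nat.mod_eq_of_lt h

/-- The vertices met when going counterclockwise from `x` to `y`, excluding both ends. -/
def pathArc (x y : ZMod n) : Finset (ZMod n) :=
  {v | cyclePos (x + 1) v < cyclePos (x + 1) y}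

theorem mem_pathArc {x y v : ZMod n} :
    v ∈ pathArc x y ↔ cyclePos (x + 1) v < cyclePos (x + 1) y := by simp [pathArc]

theorem mem_pathArc_of_lt {o x y : ZMod n} (h : cyclePos o x < cyclePos o y) (v : ZMod n) :
    v ∈ pathArc x y ↔ cyclePos o x < cyclePos o v ∧ cyclePos o v < cyclePos o y := by
  rw [mem_pathArc]
  have h1 := cyclePos_add_one_self x
  have h2 := cyclePos_add_one_left (x := x) (v := y) (by rintro rfl; omega)
  have h3 := cyclePos_change o x v
  have h4 := cyclePos_change o x y
  have h5 := cyclePos_lt o v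
  have h6 := cyclePos_lt o y
  have h7 := cyclePos_lt x y
  by_cases hv : v = x
  · subst hv
    omega
  · have := cyclePos_ne (o := o) hv
    have := cyclePos_add_one_left hv
    omega

theorem mem_pathArc_of_le {o x y : ZMod n} (h : cyclePos o y ≤ cyclePos o x) (v : ZMod n) :
    v ∈ pathArc x y ↔ cyclePos o x < cyclePos o v ∨ cyclePos o v < cyclePos o y := by
  rw [mem_pathArc]
  have h1 := cyclePos_add_one_self x
  have h3 := cyclePos_change o x v
  have h4 := cyclePos_change o x y
  have h5 := cyclePos_lt o v
  have h6 := cyclePos_lt o y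
  have h7 := cyclePos_lt (x + 1) y
  have h8 := cyclePos_lt (x + 1) v
  by_cases hv : v = x
  · subst hv
    omega
  · have := cyclePos_ne (o := o) hv
    have := cyclePos_add_one_left hv
    by_cases hy : y = x
    · subst hy
      omega
    · have := cyclePos_ne (o := o) hy
      have := cyclePos_add_one_left hy
      omega

theorem dPathCount_eq_assignCount (d : ℕ) (T : Finset (Finset (ZMod n))) (i j : ZMod n) :
    dPathCount n d T i j = assignCount (d - 2) T (pathArc i j) := by
  classical
  have hlen : pathLen n i j = cyclePos (i + 1) j := by rw [pathLen, cyclePos, sub_sub]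
  have hidx : ∀ k < n, cyclePos (i + 1) (i + 1 + (k : ZMod n)) = k := fun k hk => by
    rw [cyclePos, add_sub_cancel_left, ZMod.val_natCast_of_lt hk]
  have hidx' : ∀ v : ZMod n, i + 1 + (cyclePos (i + 1) v : ZMod n) = v := fun v => by
    rw [cyclePos, ZMod.natCast_zmod_val, add_sub_cancel]
  have hlt : ∀ k : Fin (pathLen n i j), (k : ℕ) < n := fun k =>
    k.2.trans (hlen ▸ cyclePos_lt _ _)
  have hmem : ∀ {v}, v ∈ pathArc i j ↔ cyclePos (i + 1) v < pathLen n i j := by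
    intro v; rw [mem_pathArc, hlen]
  have hmem' : ∀ k : Fin (pathLen n i j), i + 1 + ((k : ℕ) : ZMod n) ∈ pathArc i j := fun k => by
    rw [hmem, hidx _ (hlt k)]; exact k.2
  have hcount : ∀ (q : Fin (pathLen n i j) → Finset (ZMod n)) (Q : ZMod n → Finset (ZMod n))
      (_ : ∀ k : Fin (pathLen n i j), Q (i + 1 + ((k : ℕ) : ZMod n)) = q k) (c : Finset (ZMod n)),
      #{k | q k = c} = #{v ∈ pathArc i j | Q v = c} := by
    intro q Q hQ c
    refine card_bij (fun k _ => i + 1 + ((k : ℕ) : ZMod n)) ?_ ?_ ?_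
    · intro k hk
      rw [mem_filter] at hk ⊢
      exact ⟨hmem' k, (hQ k).trans hk.2⟩
    · intro k _ l _ hkl
      have := congrArg (cyclePos (i + 1)) hkl
      rw [hidx _ (hlt k), hidx _ (hlt l)] at this
      exact Fin.ext this
    · intro v hv
      rw [mem_filter, hmem] at hv
      refine ⟨⟨_, hv.1⟩, ?_, hidx' v⟩
      rw [mem_filter, ← hQ, hidx']
      exact ⟨mem_univ _, hv.2⟩
  rw [dPathCount, assignCount_eq_natCard]
  have hQ : ∀ (q : Fin (pathLen n i j) → {c // c ∈ T}) (k : Fin (pathLen n i j)),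
      (if h : cyclePos (i + 1) (i + 1 + ((k : ℕ) : ZMod n)) < pathLen n i j
        then (q ⟨_, h⟩ : Finset (ZMod n)) else ∅) = q k := by
    intro q k
    rw [dif_pos (by rw [hidx _ (hlt k)]; exact k.2)]
    congr
    exact hidx _ (hlt k)
  refine Nat.card_congr
    { toFun := fun q => ⟨fun v => if h : cyclePos (i + 1) v < pathLen n i j then q.1 ⟨_, h⟩ else ∅,
        ?_, ?_, ?_⟩
      invFun := fun Q => ⟨fun k => ⟨Q.1 (i + 1 + ((k : ℕ) : ZMod n)), (Q.2.1 _ (hmem' k)).1⟩,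
        fun k => (Q.2.1 _ (hmem' k)).2, ?_⟩
      left_inv := ?_
      right_inv := ?_ }
  · intro v hv
    rw [hmem] at hv
    simp only [dif_pos hv]
    refine ⟨(q.1 _).2, ?_⟩
    have := q.2.1 ⟨_, hv⟩
    rwa [hidx'] at this
  · intro v hv
    rw [hmem] at hv
    exact dif_neg hv
  · intro c hc
    exact (hcount (fun k => q.1 k)
      (fun v => if h : cyclePos (i + 1) v < pathLen n i j then q.1 ⟨_, h⟩ else ∅)
      (hQ q.1) c).ge.trans (q.2.2 c hc)
  · intro c hc
    exact (hcount (fun k => Q.1 (i + 1 + ((k : ℕ) : ZMod n))) Q.1 (fun _ => rfl) c).le.trans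
      (Q.2.2.2 c hc)
  · intro q
    ext1; ext1 k; ext1
    exact hQ q.1 k
  · intro Q
    ext1; ext1 v
    by_cases hv : cyclePos (i + 1) v < pathLen n i j
    · simp only [dif_pos hv, hidx']
    · simp only [dif_neg hv]
      exact (Q.2.2.1 v (by rwa [hmem])).symm

end Paths

section PathCount

open Finset

variable {n : ℕ} [NeZero n]

theorem cyclePos_inside_iff {o a b : ZMod n} (hab : cyclePos o a < cyclePos o b) (v : ZMod n) :
    cyclePos b b ≤ cyclePos b v ∧ cyclePos b v ≤ cyclePos b a ↔
      cyclePos o v ≤ cyclePos o a ∨ cyclePos o b ≤ cyclePos o v := by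
  have h1 := cyclePos_change o b v
  have h2 := cyclePos_change o b a
  have h3 := cyclePos_self b
  have h4 := cyclePos_lt o v
  omega

theorem cyclePos_outside_iff {o a b : ZMod n} (hab : cyclePos o a < cyclePos o b) (v : ZMod n) :
    cyclePos b v ≤ cyclePos b b ∨ cyclePos b a ≤ cyclePos b v ↔
      cyclePos o a ≤ cyclePos o v ∧ cyclePos o v ≤ cyclePos o b := by
  have h1 := cyclePos_change o b v
  have h2 := cyclePos_change o b a
  have h3 := cyclePos_self b
  have h4 := cyclePos_lt o v
  have h5 := cyclePos_lt o b
  have h6 : cyclePos b v = 0 → cyclePos o v = cyclePos o b := fun h => by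
    rw [cyclePos_injective b (h.trans h3.symm)]
  omega

theorem cyclePos_rotate_lt {o a b : ZMod n} (hab : cyclePos o a < cyclePos o b) :
    cyclePos b b < cyclePos b a := by
  have h2 := cyclePos_change o b a
  have h3 := cyclePos_self b
  have h5 := cyclePos_lt o b
  omega

theorem Uncrossed.rotate {T : Finset (Finset (ZMod n))} {o a b : ZMod n}
    (h : Uncrossed (cyclePos o) T a b) (hab : cyclePos o a < cyclePos o b) :
    Uncrossed (cyclePos b) T b a := fun c hc => by
  simp only [cyclePos_inside_iff hab, cyclePos_outside_iff hab]
  exact (h c hc).symm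

theorem pathArc_eq_openInterval {o x y : ZMod n} (h : cyclePos o x < cyclePos o y) :
    pathArc x y = openInterval (cyclePos o) x y := by
  ext v
  rw [mem_pathArc_of_lt h, mem_openInterval]

variable {d : ℕ} {T : Finset (Finset (ZMod n))} (hd : 3 ≤ d) (hT : IsDAngulation n d T)

include hd hT

theorem dPathCount_self (hn : 2 ≤ n) (x : ZMod n) : dPathCount n d T x x = 0 := by
  classical
  rw [dPathCount_eq_assignCount]
  by_contra h
  have h1 := card_le_of_assignCount_ne_zero h
  have hx := cyclePos_add_one_self x
  have h0 := cyclePos_self (x + 1)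
  have hin : ∀ v, cyclePos (x + 1) (x + 1) ≤ cyclePos (x + 1) v ∧
      cyclePos (x + 1) v ≤ cyclePos (x + 1) x := fun v => by
    have := cyclePos_lt (x + 1) v
    omega
  have h2 := ((hT.isAngulated hd (x + 1)).isTight_within (u := x + 1) (w := x) (by omega)
    fun c _ => Or.inl fun v _ => hin v).1
  have h3 : within (cyclePos (x + 1)) T (x + 1) x = T := by
    ext c
    rw [mem_within_iff]
    exact and_iff_left fun v _ => hin v
  have h4 : openInterval (cyclePos (x + 1)) (x + 1) x ⊂ pathArc x x := by
    rw [ssubset_iff_of_subset fun v hv => mem_pathArc.2 (mem_openInterval.1 hv).2]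
    refine ⟨x + 1, mem_pathArc.2 (by omega), fun h => ?_⟩
    have := (mem_openInterval.1 h).1
    omega
  have := card_lt_card h4
  rw [h3] at h2
  omega

theorem dPathCount_of_mem_cell {c : Finset (ZMod n)} (hc : c ∈ T) {x y : ZMod n} (hx : x ∈ c)
    (hy : y ∈ c) (hxy : x ≠ y) : dPathCount n d T x y = 1 := by
  have h1 := cyclePos_self x
  have h2 := cyclePos_ne (o := x) hxy
  have h3 : cyclePos x x < cyclePos x y := by omega
  rw [dPathCount_eq_assignCount, pathArc_eq_openInterval h3]
  exact (hT.isAngulated hd x).assignCount_openInterval hc hx hy h3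

/-- The Ptolemy relation for path counts across a side of a cell. -/
theorem dPathCount_ptolemy (hn : 2 ≤ n) {o a b x y : ZMod n} {c : Finset (ZMod n)} (hc : c ∈ T)
    (ha : a ∈ c) (hb : b ∈ c) (hab : cyclePos o a < cyclePos o b)
    (hun : Uncrossed (cyclePos o) T a b)
    (hx : cyclePos o x ≤ cyclePos o a ∨ cyclePos o b ≤ cyclePos o x)
    (hy : cyclePos o a ≤ cyclePos o y ∧ cyclePos o y ≤ cyclePos o b) :
    dPathCount n d T x y = dPathCount n d T x a * dPathCount n d T b y +
      dPathCount n d T x b * dPathCount n d T a y := by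
  have hne : a ≠ b := by rintro rfl; omega
  have hself := dPathCount_self hd hT hn
  have hab1 := dPathCount_of_mem_cell hd hT hc ha hb hne
  have hba1 := dPathCount_of_mem_cell hd hT hc hb ha hne.symm
  rcases eq_or_ne x a with rfl | hxa
  · simp [hself, hab1]
  rcases eq_or_ne x b with rfl | hxb
  · simp [hself, hba1]
  rcases eq_or_ne y a with rfl | hya
  · simp [hself, hba1]
  rcases eq_or_ne y b with rfl | hyb
  · simp [hself, hab1]
  have kxa := cyclePos_ne (o := o) hxa
  have kxb := cyclePos_ne (o := o) hxb
  have kya := cyclePos_ne (o := o) hya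
  have kyb := cyclePos_ne (o := o) hyb
  have hA := hT.isAngulated hd o
  have hB := hT.isAngulated hd b
  have t₁ := hA.isTight_within hab hun
  have t₂ := hB.isTight_within (cyclePos_rotate_lt hab) (hun.rotate hab)
  rw [← pathArc_eq_openInterval hab] at t₁
  rw [← pathArc_eq_openInterval (cyclePos_rotate_lt hab)] at t₂
  have hmem₁ : ∀ {c}, c ∈ within (cyclePos o) T a b ↔ c ∈ T ∧ ∀ v ∈ c,
      cyclePos o a ≤ cyclePos o v ∧ cyclePos o v ≤ cyclePos o b := mem_within_iff
  have hmem₂ : ∀ {c}, c ∈ within (cyclePos b) T b a ↔ c ∈ T ∧ ∀ v ∈ c,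
      cyclePos o v ≤ cyclePos o a ∨ cyclePos o b ≤ cyclePos o v := by
    intro c
    simp only [mem_within_iff, cyclePos_inside_iff hab]
  have eq_iff : ∀ {v}, v = a ↔ cyclePos o v = cyclePos o a := fun {v} =>
    (cyclePos_injective o).eq_iff.symm
  have arc₁ := mem_pathArc_of_lt hab
  have arc₂ := mem_pathArc_of_le hab.le
  have arcB := mem_pathArc_of_lt (o := o) (x := a) (y := y) (by omega)
  have arcY := mem_pathArc_of_le (o := o) (x := b) (y := y) (by omega)
  simp only [dPathCount_eq_assignCount]
  refine assignCount_ptolemy t₁ t₂ ?_ ?_ ?_ ?_ ?_ (a := a) ?_ ?_ ?_ ?_ ?_ ?_ ?_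
  · rw [disjoint_left]
    intro c' h₁ h₂
    obtain ⟨v, hv, hva, hvb⟩ := hA.not_subset_pair (hmem₁.1 h₁).1 a b
    have := (hmem₁.1 h₁).2 v hv
    have := (hmem₂.1 h₂).2 v hv
    have := cyclePos_ne (o := o) hva
    have := cyclePos_ne (o := o) hvb
    omega
  · intro c'
    rw [hmem₁, hmem₂, ← and_or_left]
    exact ⟨fun h => ⟨h, hun c' h⟩, And.left⟩
  · rw [disjoint_left]
    intro v h₁ h₂
    rw [arc₁] at h₁
    rw [arc₂] at h₂
    omega
  · intro c' h
    rw [disjoint_left]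
    intro v h₁ h₂
    rw [arc₁] at h₂
    have := (hmem₂.1 h).2 v h₁
    omega
  · intro c' h
    rw [disjoint_left]
    intro v h₁ h₂
    rw [arc₂] at h₂
    have := (hmem₁.1 h).2 v h₁
    omega
  · rw [arc₁]; omega
  · rw [arc₂]; omega
  · intro v
    rw [arc₂]
    rcases lt_or_gt_of_ne kxa with h | h
    · rw [mem_pathArc_of_lt h]; omega
    · rw [mem_pathArc_of_le h.le]; omega
  · intro v
    rw [arc₁, arcB]
    omega
  · intro v
    rw [arcB, eq_iff]
    rcases lt_or_gt_of_ne kxa with h | h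
    · rw [mem_pathArc_of_lt h, mem_pathArc_of_lt (o := o) (by omega)]; omega
    · rw [mem_pathArc_of_le h.le, mem_pathArc_of_le (o := o) (by omega)]; omega
  · intro v
    rw [arcB, arc₂, arcY, eq_iff]
    omega
  · intro v
    rw [arc₁, eq_iff]
    rcases lt_or_gt_of_ne kxa with h | h
    · rw [mem_pathArc_of_lt h, mem_pathArc_of_lt (o := o) (by omega)]; omega
    · rw [mem_pathArc_of_le h.le, mem_pathArc_of_le (o := o) (by omega)]; omega

end PathCount

section Hinges

variable {n : ℕ}

/-- The `2 × 2` minor of path counts with rows `x`, `x'` and columns `y`, `y'` in this order. -/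
def hingeDet (d : ℕ) (T : Finset (Finset (ZMod n))) (x x' y y' : ZMod n) : ℤ :=
  dPathCount n d T x y * dPathCount n d T x' y' - dPathCount n d T x y' * dPathCount n d T x' y

variable [NeZero n]

theorem inArc_imp_iff {o a b : ZMod n} (hab : cyclePos o a < cyclePos o b) (v : ZMod n) :
    (InArc n a b v → v = a ∨ v = b) ↔
      cyclePos o v ≤ cyclePos o a ∨ cyclePos o b ≤ cyclePos o v := by
  have h1 := cyclePos_change o a v
  have h2 := cyclePos_change o a b
  have h3 := cyclePos_lt o a
  have h4 := cyclePos_lt o b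
  rw [← (cyclePos_injective o).eq_iff, ← (cyclePos_injective o).eq_iff (b := b)]
  change (cyclePos a v ≤ cyclePos a b → _) ↔ _
  omega

theorem inArc_imp_iff_of_gt {o a b : ZMod n} (hab : cyclePos o a < cyclePos o b) (v : ZMod n) :
    (InArc n b a v → v = a ∨ v = b) ↔
      cyclePos o a ≤ cyclePos o v ∧ cyclePos o v ≤ cyclePos o b := by
  have h1 := cyclePos_change o b v
  have h2 := cyclePos_change o b a
  have h3 := cyclePos_lt o v
  have h4 := cyclePos_lt o b
  rw [← (cyclePos_injective o).eq_iff, ← (cyclePos_injective o).eq_iff (b := b)]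
  change (cyclePos b v ≤ cyclePos b a → _) ↔ _
  omega

omit [NeZero n] in
theorem IsCellEdge.symm {c : Finset (ZMod n)} {a b : ZMod n} (h : IsCellEdge n c a b) :
    IsCellEdge n c b a :=
  ⟨h.2.1, h.1, h.2.2.1.symm, h.2.2.2.symm.imp (fun H v hv hv' => (H v hv hv').symm)
    fun H v hv hv' => (H v hv hv').symm⟩

theorem isCellEdge_iff {o a b : ZMod n} {c : Finset (ZMod n)} (hab : cyclePos o a < cyclePos o b) :
    IsCellEdge n c a b ↔ a ∈ c ∧ b ∈ c ∧
      ((∀ v ∈ c, cyclePos o a ≤ cyclePos o v ∧ cyclePos o v ≤ cyclePos o b) ∨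
        ∀ v ∈ c, cyclePos o v ≤ cyclePos o a ∨ cyclePos o b ≤ cyclePos o v) := by
  have hne : a ≠ b := by rintro rfl; omega
  simp only [IsCellEdge, inArc_imp_iff hab, inArc_imp_iff_of_gt hab, hne, ne_eq, not_false_eq_true,
    true_and]
  rw [or_comm]

/-- Sides of a cell in terms of positions counted from `o`: the cell lies between the endpoints of
the side, or has no vertices strictly between them. -/
theorem sideOf_iff (o : ZMod n) {c : Finset (ZMod n)} {z : Sym2 (ZMod n)} :
    SideOf n c z ↔ ∃ a b, z = s(a, b) ∧ cyclePos o a < cyclePos o b ∧ a ∈ c ∧ b ∈ c ∧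
      ((∀ v ∈ c, cyclePos o a ≤ cyclePos o v ∧ cyclePos o v ≤ cyclePos o b) ∨
        ∀ v ∈ c, cyclePos o v ≤ cyclePos o a ∨ cyclePos o b ≤ cyclePos o v) := by
  constructor
  · rintro ⟨a, b, rfl, h⟩
    rcases lt_or_gt_of_ne (cyclePos_ne (o := o) h.2.2.1) with hab | hab
    · exact ⟨a, b, rfl, hab, (isCellEdge_iff hab).1 h⟩
    · exact ⟨b, a, Sym2.eq_swap, hab, (isCellEdge_iff hab).1 h.symm⟩
  · rintro ⟨a, b, rfl, hab, h⟩
    exact ⟨a, b, rfl, (isCellEdge_iff hab).2 h⟩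

omit [NeZero n] in
theorem eq_and_eq_of_mk_eq {o a b a' b' : ZMod n} (hab : cyclePos o a < cyclePos o b)
    (hab' : cyclePos o a' < cyclePos o b') (h : s(a, b) = s(a', b')) : a = a' ∧ b = b' := by
  rcases Sym2.eq_iff.1 h with h | ⟨rfl, rfl⟩
  · exact h
  · omega

theorem cyclePos_of_isBoundaryEdge (hn : 2 ≤ n) {o a b : ZMod n}
    (hab : cyclePos o a < cyclePos o b) (h : IsBoundaryEdge n s(a, b)) :
    cyclePos o b = cyclePos o a + 1 ∨ cyclePos o a = 0 ∧ cyclePos o b + 1 = n := by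
  obtain ⟨t, ht⟩ := h
  have h1 := cyclePos_change o t (t + 1)
  have h2 : cyclePos t (t + 1) = 1 := by
    have := cyclePos_add_one_right (o := t) (v := t) (by rw [cyclePos_self]; omega)
    rwa [cyclePos_self] at this
  have h3 := cyclePos_lt o t
  have h4 := cyclePos_lt o (t + 1)
  rcases Sym2.eq_iff.1 ht with ⟨rfl, rfl⟩ | ⟨rfl, rfl⟩ <;> omega

variable {d : ℕ} {T : Finset (Finset (ZMod n))} (hd : 3 ≤ d) (hT : IsDAngulation n d T)

include hd hT

theorem eq_of_outside {o a b : ZMod n} {c c' : Finset (ZMod n)} (hab : cyclePos o a < cyclePos o b)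
    (hc : c ∈ T) (hc' : c' ∈ T) (ha : a ∈ c) (hb : b ∈ c) (ha' : a ∈ c') (hb' : b ∈ c')
    (h : ∀ v ∈ c, cyclePos o v ≤ cyclePos o a ∨ cyclePos o b ≤ cyclePos o v)
    (h' : ∀ v ∈ c', cyclePos o v ≤ cyclePos o a ∨ cyclePos o b ≤ cyclePos o v) : c = c' := by
  refine (hT.isAngulated hd b).eq_of_mem_within (u := b) (w := a) ?_ ?_ hb ha hb' ha'
  · exact mem_within_iff.2 ⟨hc, fun v hv => (cyclePos_inside_iff hab v).2 (h v hv)⟩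
  · exact mem_within_iff.2 ⟨hc', fun v hv => (cyclePos_inside_iff hab v).2 (h' v hv)⟩

/-- A chord is a side of at most two cells. -/
theorem eq_of_sideOf {c₁ c₂ c₃ : Finset (ZMod n)} {z : Sym2 (ZMod n)} (hc₁ : c₁ ∈ T) (hc₂ : c₂ ∈ T)
    (hc₃ : c₃ ∈ T) (h₁ : SideOf n c₁ z) (h₂ : SideOf n c₂ z) (h₃ : SideOf n c₃ z) :
    c₁ = c₂ ∨ c₁ = c₃ ∨ c₂ = c₃ := by
  have hA := hT.isAngulated hd 0
  obtain ⟨a, b, rfl, hab, ha₁, hb₁, k₁⟩ := (sideOf_iff 0).1 h₁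
  obtain ⟨a₂, b₂, e₂, hab₂, ha₂, hb₂, k₂⟩ := (sideOf_iff 0).1 h₂
  obtain ⟨a₃, b₃, e₃, hab₃, ha₃, hb₃, k₃⟩ := (sideOf_iff 0).1 h₃
  obtain ⟨rfl, rfl⟩ := eq_and_eq_of_mk_eq hab hab₂ e₂
  obtain ⟨rfl, rfl⟩ := eq_and_eq_of_mk_eq hab hab₃ e₃
  have inside : ∀ {c c' : Finset (ZMod n)}, c ∈ T → c' ∈ T → a ∈ c → b ∈ c → a ∈ c' → b ∈ c' →
      (∀ v ∈ c, cyclePos 0 a ≤ cyclePos 0 v ∧ cyclePos 0 v ≤ cyclePos 0 b) →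
      (∀ v ∈ c', cyclePos 0 a ≤ cyclePos 0 v ∧ cyclePos 0 v ≤ cyclePos 0 b) → c = c' :=
    fun hc hc' ha hb ha' hb' h h' => hA.eq_of_mem_within (mem_within_iff.2 ⟨hc, h⟩)
      (mem_within_iff.2 ⟨hc', h'⟩) ha hb ha' hb'
  have outside := @eq_of_outside n _ d T hd hT 0 a b
  rcases k₁ with k₁ | k₁ <;> rcases k₂ with k₂ | k₂
  · exact Or.inl (inside hc₁ hc₂ ha₁ hb₁ ha₂ hb₂ k₁ k₂)
  · rcases k₃ with k₃ | k₃
    · exact Or.inr (Or.inl (inside hc₁ hc₃ ha₁ hb₁ ha₃ hb₃ k₁ k₃))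
    · exact Or.inr (Or.inr (outside hab hc₂ hc₃ ha₂ hb₂ ha₃ hb₃ k₂ k₃))
  · rcases k₃ with k₃ | k₃
    · exact Or.inr (Or.inr (inside hc₂ hc₃ ha₂ hb₂ ha₃ hb₃ k₂ k₃))
    · exact Or.inr (Or.inl (outside hab hc₁ hc₃ ha₁ hb₁ ha₃ hb₃ k₁ k₃))
  · exact Or.inl (outside hab hc₁ hc₂ ha₁ hb₁ ha₂ hb₂ k₁ k₂)

/-- Hinge determinants are multiplicative across a side of a cell. -/
theorem hingeDet_mul (hn : 2 ≤ n) {o a b x x' y y' : ZMod n} {c : Finset (ZMod n)} (hc : c ∈ T)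
    (ha : a ∈ c) (hb : b ∈ c) (hab : cyclePos o a < cyclePos o b)
    (hun : Uncrossed (cyclePos o) T a b)
    (hx : cyclePos o x ≤ cyclePos o a ∨ cyclePos o b ≤ cyclePos o x)
    (hx' : cyclePos o x' ≤ cyclePos o a ∨ cyclePos o b ≤ cyclePos o x')
    (hy : cyclePos o a ≤ cyclePos o y ∧ cyclePos o y ≤ cyclePos o b)
    (hy' : cyclePos o a ≤ cyclePos o y' ∧ cyclePos o y' ≤ cyclePos o b) :
    hingeDet d T x x' y y' = hingeDet d T x x' a b * hingeDet d T b a y y' := by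
  have P := @dPathCount_ptolemy n _ d T hd hT hn o a b
  simp only [hingeDet]
  rw [P hc ha hb hab hun hx hy, P hc ha hb hab hun hx' hy', P hc ha hb hab hun hx hy',
    P hc ha hb hab hun hx' hy]
  push_cast
  ring

theorem hingeDet_eq_one (hn : 2 ≤ n) {a b a' b' : ZMod n} {c : Finset (ZMod n)} (hc : c ∈ T)
    (ha : a ∈ c) (hb : b ∈ c) (ha' : a' ∈ c) (hb' : b' ∈ c) (h₁ : b ≠ a') (h₂ : a ≠ b')
    (h : a = a' ∨ b = b') : hingeDet d T b a a' b' = 1 := by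
  rw [hingeDet, dPathCount_of_mem_cell hd hT hc hb ha' h₁,
    dPathCount_of_mem_cell hd hT hc ha hb' h₂]
  rcases h with rfl | rfl <;> simp [dPathCount_self hd hT hn]

theorem hingeDet_eq_zero {a b a' b' : ZMod n} {c : Finset (ZMod n)} (hc : c ∈ T)
    (ha : a ∈ c) (hb : b ∈ c) (ha' : a' ∈ c) (hb' : b' ∈ c) (h₁ : b ≠ a') (h₂ : a ≠ b')
    (h₃ : a ≠ a') (h₄ : b ≠ b') : hingeDet d T b a a' b' = 0 := by
  rw [hingeDet, dPathCount_of_mem_cell hd hT hc hb ha' h₁,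
    dPathCount_of_mem_cell hd hT hc ha hb' h₂, dPathCount_of_mem_cell hd hT hc hb hb' h₄,
    dPathCount_of_mem_cell hd hT hc ha ha' h₃]
  simp

end Hinges

section Chains

variable {n : ℕ}

/-- The chords `z` form a chain of hinges through the pairwise distinct cells `p` of `T`. -/
def IsHingeChain (T : Finset (Finset (ZMod n))) {s : ℕ} (z : Fin (s + 1) → Sym2 (ZMod n))
    (p : Fin s → Finset (ZMod n)) : Prop :=
  (∀ k : Fin (s + 1), k ≠ 0 → k ≠ Fin.last s → IsDiagonal n T (z k)) ∧
  (∀ k : Fin s, p k ∈ T ∧ SideOf n (p k) (z k.castSucc) ∧ SideOf n (p k) (z k.succ)) ∧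
  Function.Injective p ∧
  ∀ k : Fin s, ∃ x, x ∈ z k.castSucc ∧ x ∈ z k.succ

theorem IsHingeChain.cons {T : Finset (Finset (ZMod n))} {s : ℕ} {z : Fin (s + 1) → Sym2 (ZMod n)}
    {p : Fin s → Finset (ZMod n)} (h : IsHingeChain T z p) {y : Sym2 (ZMod n)}
    {c : Finset (ZMod n)} (hc : c ∈ T) (hy : SideOf n c y) (hz : SideOf n c (z 0))
    (hdiag : s ≠ 0 → ¬ IsBoundaryEdge n (z 0)) (hcp : ∀ k, p k ≠ c)
    (hshare : ∃ x, x ∈ y ∧ x ∈ z 0) :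
    IsHingeChain T (Fin.cons y z : Fin (s + 1 + 1) → Sym2 (ZMod n)) (Fin.cons c p) := by
  obtain ⟨h₁, h₂, h₃, h₄⟩ := h
  refine ⟨?_, ?_, ?_, ?_⟩
  · intro k hk hk'
    obtain ⟨l, rfl⟩ := Fin.exists_succ_eq.2 hk
    rw [Fin.cons_succ]
    have hl : l ≠ Fin.last s := fun e => hk' (by rw [e, Fin.succ_last])
    by_cases hl0 : l = 0
    · subst hl0
      exact ⟨⟨c, hc, hz⟩, hdiag (by rintro rfl; exact hl rfl)⟩
    · exact h₁ l hl0 hl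
  · intro k
    cases k using Fin.cases with
    | zero => exact ⟨hc, hy, hz⟩
    | succ k => exact h₂ k
  · rw [Fin.cons_injective_iff]
    exact ⟨fun ⟨k, hk⟩ => hcp k hk, h₃⟩
  · intro k
    cases k using Fin.cases with
    | zero => exact hshare
    | succ k => exact h₄ k

variable [NeZero n] {d : ℕ} {T : Finset (Finset (ZMod n))} (hd : 3 ≤ d) (hT : IsDAngulation n d T)

include hd hT

theorem exists_isHingeChain (hn : 2 ≤ n) {o j a b : ZMod n}
    (hj : cyclePos o (j + 1) = cyclePos o j + 1) (haj : cyclePos o a ≤ cyclePos o j)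
    (hjb : cyclePos o (j + 1) ≤ cyclePos o b) (hun : Uncrossed (cyclePos o) T a b)
    (hdet : hingeDet d T b a j (j + 1) = 1) :
    ∃ (s : ℕ) (z : Fin (s + 1) → Sym2 (ZMod n)) (p : Fin s → Finset (ZMod n)),
      z 0 = s(a, b) ∧ z (Fin.last s) = s(j, j + 1) ∧ IsHingeChain T z p ∧
      (∀ k, p k ∈ within (cyclePos o) T a b) ∧ (a = j → b = j + 1 → s = 0) := by
  induction hk : cyclePos o b - cyclePos o a using Nat.strong_induction_on generalizing a b with
  | _ k ih =>
  subst hk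
  have hA := hT.isAngulated hd o
  have hinj := cyclePos_injective o
  by_cases hend : a = j ∧ b = j + 1
  · obtain ⟨rfl, rfl⟩ := hend
    exact ⟨0, fun _ => s(a, a + 1), Fin.elim0, rfl, rfl,
      ⟨fun k h => (h (Fin.fin_one_eq_zero k)).elim, fun k => k.elim0,
        Function.injective_of_subsingleton _, fun k => k.elim0⟩, fun k => k.elim0,
      fun _ _ => rfl⟩
  have hlen : cyclePos o a + 1 < cyclePos o b := by
    by_contra! hle
    exact hend ⟨hinj (by omega), hinj (by omega)⟩
  have hb := cyclePos_lt o b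
  obtain ⟨c, hcab, hac, hbc⟩ := hA.exists_cell a b (by omega) hun ⟨a + 1, by
    rw [mem_openInterval, cyclePos_add_one_right (by omega)]
    omega⟩
  obtain ⟨hc, hin⟩ := mem_within_iff.1 hcab
  obtain ⟨a', ha', hmax⟩ := (c.filter (cyclePos o · ≤ cyclePos o j)).exists_max_image (cyclePos o)
    ⟨a, Finset.mem_filter.2 ⟨hac, haj⟩⟩
  obtain ⟨b', hb', hmin⟩ := (c.filter (cyclePos o (j + 1) ≤ cyclePos o ·)).exists_min_image
    (cyclePos o) ⟨b, Finset.mem_filter.2 ⟨hbc, hjb⟩⟩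
  rw [Finset.mem_filter] at ha' hb'
  have hout : ∀ v ∈ c, cyclePos o v ≤ cyclePos o a' ∨ cyclePos o b' ≤ cyclePos o v := by
    intro v hv
    rcases le_or_gt (cyclePos o v) (cyclePos o j) with h | h
    · exact Or.inl (hmax v (Finset.mem_filter.2 ⟨hv, h⟩))
    · exact Or.inr (hmin v (Finset.mem_filter.2 ⟨hv, by omega⟩))
  have hab' : cyclePos o a' < cyclePos o b' := by omega
  have hina := hin a' ha'.1
  have hinb := hin b' hb'.1
  have hne : ¬ (a = a' ∧ b = b') := by
    rintro ⟨rfl, rfl⟩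
    obtain ⟨v, hv, hva, hvb⟩ := hA.not_subset_pair hc a b
    have := hin v hv
    have := hout v hv
    have := cyclePos_ne (o := o) hva
    have := cyclePos_ne (o := o) hvb
    omega
  have hne' : ¬ (cyclePos o a = cyclePos o a' ∧ cyclePos o b = cyclePos o b') := fun h =>
    hne ⟨hinj h.1, hinj h.2⟩
  have hun' := hA.uncrossed_of_side hc ha'.1 hb'.1 hout
  have hmul := hingeDet_mul hd hT hn (x := b) (x' := a) (y := j) (y' := j + 1) hc ha'.1 hb'.1 hab'
    hun' (by omega) (by omega) (by omega) (by omega)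
  have hba' : b ≠ a' := by rintro rfl; omega
  have hab'' : a ≠ b' := by rintro rfl; omega
  have hshare : a = a' ∨ b = b' := by
    by_contra! h
    rw [hingeDet_eq_zero hd hT hc hac hbc ha'.1 hb'.1 hba' hab'' h.1 h.2, hdet] at hmul
    omega
  rw [hingeDet_eq_one hd hT hn hc hac hbc ha'.1 hb'.1 hba' hab'' hshare, hdet, one_mul] at hmul
  obtain ⟨s, z, p, hz₀, hz₁, hzp, hp, hs⟩ := ih _ (by omega) ha'.2 hb'.2 hun' hmul.symm rfl
  refine ⟨s + 1, Fin.cons s(a, b) z, Fin.cons c p, rfl, ?_, ?_, ?_, fun h h' => absurd ⟨h, h'⟩ hend⟩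
  · rw [← Fin.succ_last, Fin.cons_succ, hz₁]
  · refine hzp.cons hc ?_ ?_ ?_ ?_ ?_
    · exact (sideOf_iff o).2 ⟨a, b, rfl, by omega, hac, hbc, Or.inl hin⟩
    · exact (sideOf_iff o).2 ⟨a', b', hz₀, hab', ha'.1, hb'.1, Or.inr hout⟩
    · intro hs0 hbd
      rw [hz₀] at hbd
      rcases cyclePos_of_isBoundaryEdge hn hab' hbd with h | h
      · exact hs0 (hs (hinj (by omega)) (hinj (by omega)))
      · omega
    · rintro k rfl
      have h1 := (mem_within_iff.1 (hp k)).2 a hac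
      have h2 := (mem_within_iff.1 (hp k)).2 b hbc
      omega
    · rw [hz₀]
      rcases hshare with rfl | rfl
      · exact ⟨a, by simp, by simp⟩
      · exact ⟨b, by simp, by simp⟩
  · intro k
    cases k using Fin.cases with
    | zero => exact hcab
    | succ k =>
      obtain ⟨h1, h2⟩ := mem_within_iff.1 (hp k)
      refine mem_within_iff.2 ⟨h1, fun v hv => ?_⟩
      have := h2 v hv
      omega

/-- Consecutive chords of a chain of hinges joining distinct boundary edges are distinct. -/
theorem IsHingeChain.ne {s : ℕ} {z : Fin (s + 1) → Sym2 (ZMod n)} {p : Fin s → Finset (ZMod n)}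
    (h : IsHingeChain T z p) (h₀ : IsBoundaryEdge n (z 0)) (h₁ : IsBoundaryEdge n (z (Fin.last s)))
    (hne : z 0 ≠ z (Fin.last s)) (k : Fin s) : z k.castSucc ≠ z k.succ := by
  intro heq
  obtain ⟨hdiag, hside, hinj, -⟩ := h
  obtain ⟨k, hk⟩ := k
  by_cases hk0 : k = 0
  · subst hk0
    by_cases hs : s = 1
    · subst hs
      exact hne heq
    · exact (hdiag (Fin.succ ⟨0, hk⟩) (Fin.succ_ne_zero _)
        (by simp [Fin.ext_iff]; omega)).2 (heq ▸ h₀)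
  by_cases hks : k + 1 = s
  · subst hks
    exact (hdiag (Fin.castSucc ⟨k, hk⟩) (by simpa [Fin.ext_iff] using hk0)
      (by simp [Fin.ext_iff])).2 (heq ▸ h₁)
  obtain ⟨l, rfl⟩ := Nat.exists_eq_succ_of_ne_zero hk0
  have e₁ := hside ⟨l, by omega⟩
  have e₂ := hside ⟨l + 1, hk⟩
  have e₃ := hside ⟨l + 2, by omega⟩
  have := eq_of_sideOf hd hT e₁.1 e₂.1 e₃.1 e₁.2.2 e₂.2.1
    (by rw [show Fin.succ ⟨l, _⟩ = Fin.castSucc ⟨l + 1, hk⟩ from rfl, heq]; exact e₃.2.1)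
  simp [hinj.eq_iff] at this

theorem IsHingeChain.hingeDet_eq_one (hn : 2 ≤ n) {s : ℕ} {z : Fin (s + 1) → Sym2 (ZMod n)}
    {p : Fin s → Finset (ZMod n)} (h : IsHingeChain T z p) {i : ZMod n} (h₀ : z 0 = s(i, i + 1))
    (hs : s ≠ 0) (hne : ∀ k : Fin s, z k.castSucc ≠ z k.succ) (k : ℕ) (hk : k < s + 1) :
    ∃ a b, z ⟨k, hk⟩ = s(a, b) ∧ cyclePos (i + 1) a < cyclePos (i + 1) b ∧
      hingeDet d T i (i + 1) a b = 1 ∧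
      Uncrossed (cyclePos (i + 1)) T a b ∧
      ∀ hk' : k < s, p ⟨k, hk'⟩ ∈ within (cyclePos (i + 1)) T a b ∧ a ∈ p ⟨k, hk'⟩ ∧
        b ∈ p ⟨k, hk'⟩ := by
  have hA := hT.isAngulated hd (i + 1)
  have hinj := cyclePos_injective (i + 1)
  have hpi := cyclePos_add_one_self i
  have hpi' := cyclePos_self (i + 1)
  obtain ⟨-, hside, hpinj, hshare⟩ := h
  induction k with
  | zero =>
    have hlt : cyclePos (i + 1) (i + 1) < cyclePos (i + 1) i := by omega
    have hin : ∀ v, cyclePos (i + 1) (i + 1) ≤ cyclePos (i + 1) v ∧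
        cyclePos (i + 1) v ≤ cyclePos (i + 1) i := fun v => by
      have := cyclePos_lt (i + 1) v
      omega
    have hs' : 0 < s := Nat.pos_of_ne_zero hs
    obtain ⟨hpT, hp, -⟩ := hside ⟨0, hs'⟩
    obtain ⟨a, b, hab, hlt', ha, hb, -⟩ := (sideOf_iff (i + 1)).1 hp
    obtain ⟨rfl, rfl⟩ := eq_and_eq_of_mk_eq hlt hlt' (Sym2.eq_swap.trans (h₀.symm.trans hab))
    have hne' : i ≠ i + 1 := fun e => by rw [← e] at hlt; omega
    exact ⟨i + 1, i, h₀.trans Sym2.eq_swap, hlt,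
      _root_.hingeDet_eq_one hd hT hn hpT ha hb ha hb hne' hne'.symm (Or.inl rfl),
      fun c _ => Or.inl fun v _ => hin v,
      fun _ => ⟨mem_within_iff.2 ⟨hpT, fun v _ => hin v⟩, ha, hb⟩⟩
  | succ k ih =>
    obtain ⟨a, b, hz, hab, hdet, hun, hp⟩ := ih (by omega)
    obtain ⟨hpw, hap, hbp⟩ := hp (by omega)
    obtain ⟨hpT, hin⟩ := mem_within_iff.1 hpw
    obtain ⟨a', b', hz', hab', ha', hb', hor⟩ :=
      (sideOf_iff (i + 1)).1 (hside ⟨k, by omega⟩).2.2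
    have hina := hin a' ha'
    have hinb := hin b' hb'
    have hout := hor.resolve_left fun hin' => by
      have h1 := hin' a hap
      have h2 := hin' b hbp
      refine hne ⟨k, by omega⟩ ?_
      rw [hz', ← hinj (show cyclePos (i + 1) a = cyclePos (i + 1) a' by omega),
        ← hinj (show cyclePos (i + 1) b = cyclePos (i + 1) b' by omega)]
      exact hz
    have hun' := hA.uncrossed_of_side hpT ha' hb' hout
    have hba' : b ≠ a' := by rintro rfl; omega
    have hab'' : a ≠ b' := by rintro rfl; omega
    have hsh : a = a' ∨ b = b' := by
      obtain ⟨x, hx, hx'⟩ := hshare ⟨k, by omega⟩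
      rw [hz', Sym2.mem_iff] at hx'
      rw [show z (Fin.castSucc ⟨k, _⟩) = s(a, b) from hz, Sym2.mem_iff] at hx
      rcases hx with rfl | rfl
      · exact Or.inl (hx'.resolve_right hab'')
      · exact Or.inr (hx'.resolve_left hba')
    have hmul := hingeDet_mul hd hT hn (x := i) (x' := i + 1) (y := a') (y' := b') hpT hap hbp hab
      hun (by have := cyclePos_lt (i + 1) b; omega) (by omega) hina hinb
    rw [hdet, _root_.hingeDet_eq_one hd hT hn hpT hap hbp ha' hb' hba' hab'' hsh, one_mul] at hmul
    refine ⟨a', b', hz', hab', hmul, hun', fun hk' => ?_⟩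
    obtain ⟨hqT, hq, -⟩ := hside ⟨k + 1, hk'⟩
    obtain ⟨a₁, b₁, hz₁, hab₁, ha₁, hb₁, hor₁⟩ := (sideOf_iff (i + 1)).1 hq
    obtain ⟨rfl, rfl⟩ := eq_and_eq_of_mk_eq hab' hab₁ (hz'.symm.trans hz₁)
    refine ⟨mem_within_iff.2 ⟨hqT, hor₁.resolve_right fun hout₁ => ?_⟩, ha₁, hb₁⟩
    have := hpinj (eq_of_outside hd hT hab' hpT hqT ha' hb' ha₁ hb₁ hout hout₁)
    simp at this

end Chains

/-- For a `d`-angulation `T` of the convex `n`-gon and distinct boundary edges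
`e = (i,i+1)`, `f = (j,j+1)`, the adjacent `2×2` determinant `d(e,f)` equals `1`
if and only if there is a sequence `e = z_0, z_1, …, z_s = f`, with
`z_1, …, z_{s-1}` diagonals of `T`, such that for every `k`: `z_k` and `z_{k+1}`
are sides of a common `d`-gon `p_k` of `T`, the `d`-gons `p_0, …, p_{s-1}` are
pairwise distinct, and `z_k` shares an endpoint with `z_{k+1}`. -/
theorem hinge_det_eq_one_iff (d m n : ℕ) (hd : 3 ≤ d) (hn : n = d + m * (d - 2))
    (T : Finset (Finset (ZMod n))) (hT : IsDAngulation n d T) (i j : ZMod n)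
    (hij : i ≠ j) :
    (dPathCount n d T i j : ℤ) * dPathCount n d T (i + 1) (j + 1)
        - dPathCount n d T i (j + 1) * dPathCount n d T (i + 1) j = 1 ↔
    ∃ (s : ℕ) (z : Fin (s + 1) → Sym2 (ZMod n)) (p : Fin s → Finset (ZMod n)),
      z 0 = s(i, i + 1) ∧
      z (Fin.last s) = s(j, j + 1) ∧
      (∀ k : Fin (s + 1), k ≠ 0 → k ≠ Fin.last s → IsDiagonal n T (z k)) ∧
      (∀ k : Fin s, p k ∈ T ∧ SideOf n (p k) (z k.castSucc) ∧
        SideOf n (p k) (z k.succ)) ∧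
      Function.Injective p ∧
      (∀ k : Fin s, ∃ x, x ∈ z k.castSucc ∧ x ∈ z k.succ) := by
  have hn3 : 3 ≤ n := by omega
  have : NeZero n := ⟨by omega⟩
  have hi := cyclePos_add_one_self i
  have h0 := cyclePos_self (i + 1)
  have hjlt : cyclePos (i + 1) j + 1 < n := by
    have := cyclePos_lt (i + 1) j
    have := cyclePos_ne (o := i + 1) hij
    omega
  have hj := cyclePos_add_one_right hjlt
  have hlt : cyclePos (i + 1) j < cyclePos (i + 1) (j + 1) := by omega
  constructor
  · intro hdet
    obtain ⟨s, z, p, hz₀, hz₁, hzp, -⟩ := exists_isHingeChain hd hT (by omega) (a := i + 1) (b := i)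
      hj (by omega) (by omega)
      (fun c _ => Or.inl fun v _ => by have := cyclePos_lt (i + 1) v; omega) hdet
    exact ⟨s, z, p, hz₀.trans Sym2.eq_swap, hz₁, hzp⟩
  · rintro ⟨s, z, p, hz₀, hz₁, hzp⟩
    have hef : z 0 ≠ z (Fin.last s) := by
      rw [hz₀, hz₁, Sym2.eq_swap]
      intro h
      obtain ⟨h₁, h₂⟩ := eq_and_eq_of_mk_eq (o := i + 1) (by omega) hlt h
      have := congrArg (cyclePos (i + 1)) h₁
      have := congrArg (cyclePos (i + 1)) h₂
      omega
    have hs : s ≠ 0 := by rintro rfl; exact hef rfl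
    have hzp' : IsHingeChain T z p := hzp
    obtain ⟨a, b, hz, hab, hdet, -⟩ := hzp'.hingeDet_eq_one hd hT (by omega) hz₀ hs
      (hzp'.ne hd hT ⟨i, hz₀⟩ ⟨j, hz₁⟩ hef) s (Nat.lt_succ_self s)
    obtain ⟨rfl, rfl⟩ := eq_and_eq_of_mk_eq hab hlt (hz.symm.trans hz₁)
    exact hdet
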